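/- arXiv:2403.09310 — 7 statements merged into one kernel-verified Lean document; each statement's English description precedes it below -/
import Mathlib

section
/- Let n ≥ 1, let x = (z,y) ∈ ℝ^{d'}×ℝ, and let μ be a probability measure on ℝ×ℝ^{d'} with ∫|c| dμ(c,w) < ∞. Then the pushforward measure (SGD^{x,μ})_*μ satisfies ∫|c| d((SGD^{x,μ})_*μ)(c,w) ≤ C_σ·|y|/n + (1 + C_σ²/n)·∫|c| dμ(c,w). -/
open MeasureTheory ProbabilityTheory Real Set Filter
open scoped ENNReal NNReal InnerProductSpace Topology

noncomputable section

attribute [local instance] MeasureTheory.Measure.Subtype.measureSpace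

/-- Parameters `(c, w) ∈ ℝ × ℝ^{d'}`. -/
abbrev Param (d' : ℕ) := ℝ × EuclideanSpace ℝ (Fin d')
/-- Data points `(z, y) ∈ ℝ^{d'} × ℝ`. -/
abbrev Data (d' : ℕ) := EuclideanSpace ℝ (Fin d') × ℝ

/-- The network output `F(z, μ) = ∫ c·σ(zᵀw) dμ(c,w)`. -/
def netF {d' : ℕ} (σ : ℝ → ℝ) (z : EuclideanSpace ℝ (Fin d'))
    (μ : Measure (Param d')) : ℝ :=
  ∫ p, p.1 * σ ⟪z, p.2⟫_ℝ ∂μ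

/-- `g((z,y), μ) = y − F(z, μ)`. -/
def lossG {d' : ℕ} (σ : ℝ → ℝ) (x : Data d') (μ : Measure (Param d')) : ℝ :=
  x.2 - netF σ x.1 μ

/-- The gradient `A((z,y), (c,w); μ)`. -/
def gradA {d' : ℕ} (σ : ℝ → ℝ) (x : Data d') (θ : Param d')
    (μ : Measure (Param d')) : Param d' :=
  (lossG σ x μ * σ ⟪x.1, θ.2⟫_ℝ, (lossG σ x μ * θ.1 * deriv σ ⟪x.1, θ.2⟫_ℝ) • x.1)

/-- Euclidean norm on parameters `ℝ × ℝ^{d'}`. -/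
def pnorm {d' : ℕ} (θ : Param d') : ℝ := Real.sqrt (θ.1 ^ 2 + ‖θ.2‖ ^ 2)

/-- Euclidean norm on data points `ℝ^{d'} × ℝ`. -/
def dnorm {d' : ℕ} (x : Data d') : ℝ := Real.sqrt (‖x.1‖ ^ 2 + x.2 ^ 2)

/-- The SGD update map `SGD^{x,μ}(c,w) = (c,w) + (1/n)·A(x,(c,w);μ)`. -/
def sgdStep {d' : ℕ} (n : ℕ) (σ : ℝ → ℝ) (x : Data d')
    (μ : Measure (Param d')) (θ : Param d') : Param d' :=
  θ + (n : ℝ)⁻¹ • gradA σ x θ μ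

/-- the pushforward of `μ` under one SGD step has its first-coordinate
absolute moment bounded by `C_σ·|y|/n + (1 + C_σ²/n)·∫|c| dμ`. -/
theorem sgd_pushforward_moment_bound {d' : ℕ} (hd' : 1 ≤ d') (σ : ℝ → ℝ) (Cσ : ℝ)
    (hCσ : 1 ≤ Cσ) (hσdiff : Differentiable ℝ σ) (hσbd : ∀ u, |σ u| ≤ Cσ)
    (hσ'bd : ∀ u, |deriv σ u| ≤ Cσ) (n : ℕ) (hn : 1 ≤ n)
    (z : EuclideanSpace ℝ (Fin d')) (y : ℝ)
    (μ : Measure (Param d')) [IsProbabilityMeasure μ]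
    (hint : Integrable (fun p : Param d' => |p.1|) μ) :
    ∫ p, |p.1| ∂(μ.map (sgdStep n σ (z, y) μ)) ≤
      Cσ * |y| / n + (1 + Cσ ^ 2 / n) * ∫ p, |p.1| ∂μ := by
  have hCσ0 : 0 ≤ Cσ := by linarith
  have hn0 : (0 : ℝ) < n := by exact_mod_cast hn
  have hσm : Measurable σ := hσdiff.continuous.measurable
  have hdm : Measurable (deriv σ) := measurable_deriv σ
  have hin : Measurable (fun p : Param d' => ⟪z, p.2⟫_ℝ) := by fun_prop
  have hm : Measurable (sgdStep n σ (z, y) μ) := by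
    unfold sgdStep gradA
    have h1 := hσm.comp hin
    have h2 := hdm.comp hin
    simp only [Function.comp_def] at h1 h2
    fun_prop
  have hF : |netF σ z μ| ≤ Cσ * ∫ p, |p.1| ∂μ := by
    unfold netF
    rw [← integral_const_mul, ← Real.norm_eq_abs]
    refine norm_integral_le_of_norm_le (hint.const_mul Cσ) (ae_of_all _ fun p => ?_)
    rw [Real.norm_eq_abs, abs_mul, mul_comm]
    exact mul_le_mul_of_nonneg_right (hσbd _) (abs_nonneg _)
  have hG : |lossG σ (z, y) μ| ≤ |y| + Cσ * ∫ p, |p.1| ∂μ := by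
    unfold lossG
    exact (abs_sub _ _).trans (by simpa using hF)
  set I := ∫ p, |p.1| ∂μ with hI
  have hpt : ∀ p : Param d', |(sgdStep n σ (z, y) μ p).1|
      ≤ |p.1| + (n : ℝ)⁻¹ * ((|y| + Cσ * I) * Cσ) := by
    intro p
    simp only [sgdStep, gradA, Prod.fst_add, Prod.smul_fst, smul_eq_mul]
    refine (abs_add_le _ _).trans ?_
    rw [abs_mul, abs_mul, abs_of_pos (inv_pos.2 hn0)]
    have := mul_le_mul hG (hσbd ⟪z, p.2⟫_ℝ) (abs_nonneg _) ((abs_nonneg _).trans hG)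
    gcongr
  rw [integral_map hm.aemeasurable (by fun_prop)]
  calc _ ≤ ∫ p, (|p.1| + (n : ℝ)⁻¹ * ((|y| + Cσ * I) * Cσ)) ∂μ :=
        integral_mono_of_nonneg (ae_of_all _ fun p => abs_nonneg _)
          (hint.add (integrable_const _)) (ae_of_all _ hpt)
    _ = I + (n : ℝ)⁻¹ * ((|y| + Cσ * I) * Cσ) := by
        rw [integral_add hint (integrable_const _)]
        simp [hI]
    _ ≤ _ := by
        apply le_of_eq
        field_simp
        ring
end
end

section
/- Let n ≥ 1, T > 0, K ≤ nT a natural number, and let x_1 = (z_1,y_1), …, x_K = (z_K,y_K) ∈ ℝ^{d'}×ℝ. Let ν_0 be a probability measure on ℝ×ℝ^{d'} supported in the closed ball of radius C_ν ≥ 1 centered at 0, and define recursively ν_k := (SGD^{x_k, ν_{k−1}})_* ν_{k−1} for 1 ≤ k ≤ K. Then for every 0 ≤ k ≤ K one has ∫|c| dν_k(c,w) ≤ C_ν·e^{C_σ²·T} + C_σ·e^{C_σ²·T}·(1/n)·Σ_{i=1}^{K} |y_i|. -/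
open MeasureTheory ProbabilityTheory Real Set Filter
open scoped ENNReal NNReal InnerProductSpace Topology

noncomputable section

attribute [local instance] MeasureTheory.Measure.Subtype.measureSpace

theorem step_aux {d' : ℕ} (σ : ℝ → ℝ) (Cσ : ℝ) (hCσ : 1 ≤ Cσ)
    (hσdiff : Differentiable ℝ σ) (hσbd : ∀ u, |σ u| ≤ Cσ) (n : ℕ)
    (x : Data d') (μ : Measure (Param d')) [IsProbabilityMeasure μ]
    (hi : Integrable (fun p : Param d' => |p.1|) μ) :
    IsProbabilityMeasure (μ.map (sgdStep n σ x μ)) ∧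
    Integrable (fun p : Param d' => |p.1|) (μ.map (sgdStep n σ x μ)) ∧
    ∫ p, |p.1| ∂(μ.map (sgdStep n σ x μ)) ≤
      (1 + (n : ℝ)⁻¹ * Cσ ^ 2) * ∫ p, |p.1| ∂μ + (n : ℝ)⁻¹ * Cσ * |x.2| := by
  have hσm : Measurable σ := hσdiff.continuous.measurable
  have hdm : Measurable (deriv σ) := measurable_deriv σ
  have hin : Measurable (fun θ : Param d' => ⟪x.1, θ.2⟫_ℝ) := by fun_prop
  have hm : Measurable (sgdStep n σ x μ) := by
    unfold sgdStep gradA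
    have h1 := hσm.comp hin
    have h2 := hdm.comp hin
    refine measurable_id.add (Measurable.fun_const_smul (Measurable.prodMk ?_ ?_) _)
    · exact h1.const_mul _
    · exact ((measurable_fst.const_mul _).mul h2).smul_const _
  have hn0 : (0 : ℝ) ≤ (n : ℝ)⁻¹ := by positivity
  have hF : |netF σ x.1 μ| ≤ Cσ * ∫ p, |p.1| ∂μ := by
    unfold netF
    rw [← integral_const_mul, ← Real.norm_eq_abs]
    refine norm_integral_le_of_norm_le (hi.const_mul _) (ae_of_all _ fun p => ?_)
    rw [Real.norm_eq_abs, abs_mul, mul_comm]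
    exact mul_le_mul_of_nonneg_right (hσbd _) (abs_nonneg _)
  have hG : |lossG σ x μ| ≤ |x.2| + Cσ * ∫ p, |p.1| ∂μ := by
    unfold lossG
    exact (abs_sub _ _).trans (by linarith)
  have hpt : ∀ p : Param d', |(sgdStep n σ x μ p).1| ≤
      |p.1| + (n : ℝ)⁻¹ * ((|x.2| + Cσ * ∫ p, |p.1| ∂μ) * Cσ) := by
    intro p
    have : (sgdStep n σ x μ p).1 = p.1 + (n : ℝ)⁻¹ * (lossG σ x μ * σ ⟪x.1, p.2⟫_ℝ) := rfl
    rw [this]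
    refine (abs_add_le _ _).trans ?_
    rw [abs_mul, abs_mul, abs_of_nonneg hn0]
    have := mul_le_mul hG (hσbd ⟪x.1, p.2⟫_ℝ) (abs_nonneg _) ((abs_nonneg _).trans hG)
    gcongr
  have hbi : Integrable (fun p : Param d' => |p.1| +
      (n : ℝ)⁻¹ * ((|x.2| + Cσ * ∫ p, |p.1| ∂μ) * Cσ)) μ := hi.add (integrable_const _)
  have hsm : AEStronglyMeasurable (fun p : Param d' => |p.1|) (μ.map (sgdStep n σ x μ)) :=
    (by fun_prop : Measurable (fun p : Param d' => |p.1|)).aestronglyMeasurable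
  have hci : Integrable (fun p : Param d' => |(sgdStep n σ x μ p).1|) μ := by
    refine hbi.mono' ?_ (ae_of_all _ fun p => ?_)
    · exact (by fun_prop : Measurable fun p : Param d' =>
        |(sgdStep n σ x μ p).1|).aestronglyMeasurable
    · rw [Real.norm_eq_abs, abs_abs]; exact hpt p
  refine ⟨Measure.isProbabilityMeasure_map hm.aemeasurable, ?_, ?_⟩
  · exact (integrable_map_measure hsm hm.aemeasurable).2 hci
  · rw [integral_map hm.aemeasurable hsm]
    refine (integral_mono hci hbi hpt).trans (le_of_eq ?_)
    rw [integral_add hi (integrable_const _)]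
    simp only [integral_const, probReal_univ, one_smul]
    ring

/-- along the recursively pushed-forward weight measures, the
first-coordinate absolute moment stays bounded. -/
theorem recursive_pushforward_moment_bound {d' : ℕ} (hd' : 1 ≤ d') (σ : ℝ → ℝ)
    (Cσ Cν T : ℝ) (hCσ : 1 ≤ Cσ) (hCν : 1 ≤ Cν) (hT : 0 < T)
    (hσdiff : Differentiable ℝ σ) (hσbd : ∀ u, |σ u| ≤ Cσ) (hσ'bd : ∀ u, |deriv σ u| ≤ Cσ)
    (n K : ℕ) (hn : 1 ≤ n) (hK : (K : ℝ) ≤ n * T)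
    (x : ℕ → Data d') (ν : ℕ → Measure (Param d'))
    (hν0 : IsProbabilityMeasure (ν 0))
    (hsupp : ∀ᵐ p ∂(ν 0), pnorm p ≤ Cν)
    (hrec : ∀ k < K, ν (k + 1) = (ν k).map (sgdStep n σ (x (k + 1)) (ν k))) :
    ∀ k ≤ K, ∫ p, |p.1| ∂(ν k) ≤
      Cν * Real.exp (Cσ ^ 2 * T) +
        Cσ * Real.exp (Cσ ^ 2 * T) * ((n : ℝ)⁻¹ * ∑ i ∈ Finset.Icc 1 K, |(x i).2|) := by
  have hn0 : (0 : ℝ) < n := by exact_mod_cast hn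
  have hi0 : (0 : ℝ) ≤ (n : ℝ)⁻¹ := by positivity
  have hr : (1 : ℝ) ≤ 1 + (n : ℝ)⁻¹ * Cσ ^ 2 := by
    have : 0 ≤ (n : ℝ)⁻¹ * Cσ ^ 2 := by positivity
    linarith
  have habs : ∀ᵐ p ∂(ν 0), |p.1| ≤ Cν := by
    filter_upwards [hsupp] with p hp
    refine le_trans ?_ hp
    unfold pnorm
    exact Real.abs_le_sqrt (by nlinarith [sq_nonneg ‖p.2‖])
  have hi0' : Integrable (fun p : Param d' => |p.1|) (ν 0) := by
    refine (integrable_const Cν).mono' ?_ ?_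
    · exact (by fun_prop : Measurable (fun p : Param d' => |p.1|)).aestronglyMeasurable
    · filter_upwards [habs] with p hp
      rwa [Real.norm_eq_abs, abs_abs]
  have main : ∀ k ≤ K, IsProbabilityMeasure (ν k) ∧
      Integrable (fun p : Param d' => |p.1|) (ν k) ∧
      ∫ p, |p.1| ∂(ν k) ≤ (1 + (n : ℝ)⁻¹ * Cσ ^ 2) ^ k *
        (Cν + Cσ * ((n : ℝ)⁻¹ * ∑ i ∈ Finset.Icc 1 k, |(x i).2|)) := by
    intro k
    induction k with
    | zero =>
      intro _
      refine ⟨hν0, hi0', ?_⟩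
      have := integral_mono_ae hi0' (integrable_const Cν) habs
      simpa using this
    | succ k ih =>
      intro hk
      obtain ⟨h1, h2, h3⟩ := ih (by omega)
      obtain ⟨g1, g2, g3⟩ := step_aux σ Cσ hCσ hσdiff hσbd n (x (k + 1)) (ν k) h2
      rw [hrec k (by omega)]
      refine ⟨g1, g2, g3.trans ?_⟩
      rw [Finset.sum_Icc_succ_top (by omega)]
      have e1 := mul_le_mul_of_nonneg_left h3 (zero_le_one.trans hr)
      have hp : (1 : ℝ) ≤ (1 + (n : ℝ)⁻¹ * Cσ ^ 2) ^ (k + 1) := one_le_pow₀ hr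
      have hq : 0 ≤ (n : ℝ)⁻¹ * Cσ * |(x (k + 1)).2| := by positivity
      have e2 := le_mul_of_one_le_left hq hp
      refine (add_le_add e1 e2).trans (le_of_eq ?_)
      ring
  intro k hk
  refine (main k hk).2.2.trans ?_
  have hE : (1 + (n : ℝ)⁻¹ * Cσ ^ 2) ^ k ≤ Real.exp (Cσ ^ 2 * T) := by
    calc (1 + (n : ℝ)⁻¹ * Cσ ^ 2) ^ k ≤ (1 + (n : ℝ)⁻¹ * Cσ ^ 2) ^ K := pow_le_pow_right₀ hr hk
      _ ≤ (Real.exp ((n : ℝ)⁻¹ * Cσ ^ 2)) ^ K := by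
        refine pow_le_pow_left₀ (by linarith) ?_ K
        linarith [Real.add_one_le_exp ((n : ℝ)⁻¹ * Cσ ^ 2)]
      _ = Real.exp (K * ((n : ℝ)⁻¹ * Cσ ^ 2)) := (Real.exp_nat_mul _ _).symm
      _ ≤ _ := by
        refine Real.exp_le_exp.2 ?_
        have : (K : ℝ) * (n : ℝ)⁻¹ ≤ T := by
          rw [← div_eq_mul_inv, div_le_iff₀ hn0]; linarith
        nlinarith [mul_le_mul_of_nonneg_right this (sq_nonneg Cσ)]
  have hS : ∑ i ∈ Finset.Icc 1 k, |(x i).2| ≤ ∑ i ∈ Finset.Icc 1 K, |(x i).2| :=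
    Finset.sum_le_sum_of_subset_of_nonneg (Finset.Icc_subset_Icc_right hk)
      (fun _ _ _ => abs_nonneg _)
  have hS0 : 0 ≤ ∑ i ∈ Finset.Icc 1 k, |(x i).2| := Finset.sum_nonneg fun _ _ => abs_nonneg _
  have hC0 : 0 ≤ Cσ := by linarith
  have hA : Cν + Cσ * ((n : ℝ)⁻¹ * ∑ i ∈ Finset.Icc 1 k, |(x i).2|) ≤
      Cν + Cσ * ((n : ℝ)⁻¹ * ∑ i ∈ Finset.Icc 1 K, |(x i).2|) := by gcongr
  have hA0 : 0 ≤ Cν + Cσ * ((n : ℝ)⁻¹ * ∑ i ∈ Finset.Icc 1 k, |(x i).2|) := by positivity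
  refine (mul_le_mul hE hA hA0 (Real.exp_pos _).le).trans (le_of_eq ?_)
  ring
end
end

section
/- Let n ≥ 1, T > 0, K ≤ nT a natural number, data points x_1 = (z_1,y_1), …, x_K = (z_K,y_K) ∈ ℝ^{d'}×ℝ, and let ν_0 be a probability measure on ℝ×ℝ^{d'} supported in the closed ball of radius C_ν ≥ 1 centered at 0, with ν_k := (SGD^{x_k, ν_{k−1}})_* ν_{k−1} for 1 ≤ k ≤ K. Let θ_0 = (c_0,w_0) with ‖θ_0‖ ≤ C_ν and θ_k := θ_{k−1} + (1/n)·A(x_k, θ_{k−1}; ν_{k−1}) for 1 ≤ k ≤ K, writing θ_k = (c_k,w_k). Then for every 0 ≤ k ≤ K one has |c_k| ≤ 2·(1+T)·C_σ³·e^{C_σ²·T}·(C_ν + (1/n)·Σ_{i=1}^{K} |y_i|). -/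
open MeasureTheory ProbabilityTheory Real Set Filter
open scoped ENNReal NNReal InnerProductSpace Topology

noncomputable section

attribute [local instance] MeasureTheory.Measure.Subtype.measureSpace

theorem aux_meas {d' : ℕ} (n : ℕ) (σ : ℝ → ℝ) (hσ : Differentiable ℝ σ) (x : Data d')
    (μ : Measure (Param d')) : Measurable (sgdStep n σ x μ) := by
  have h1 : Measurable σ := hσ.continuous.measurable
  have h2 : Measurable (deriv σ) := measurable_deriv σ
  have h3 : Measurable (fun θ : Param d' => ⟪x.1, θ.2⟫_ℝ) :=
    (continuous_const.inner continuous_snd).measurable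
  have h4 : Measurable (fun θ : Param d' => gradA σ x θ μ) := by
    unfold gradA
    refine Measurable.prodMk ?_ ?_
    · exact (h1.comp h3).const_mul _
    · exact ((measurable_fst.const_mul _).mul (h2.comp h3)).smul_const _
  unfold sgdStep
  have h5 : Measurable (fun θ : Param d' => (n : ℝ)⁻¹ • gradA σ x θ μ) :=
    h4.const_smul ((n : ℝ)⁻¹)
  exact measurable_id.add h5

theorem aux_fst_le {d' : ℕ} (p : Param d') : |p.1| ≤ pnorm p := by
  unfold pnorm
  apply Real.abs_le_sqrt
  nlinarith [sq_nonneg ‖p.2‖]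

theorem aux_netF {d' : ℕ} (σ : ℝ → ℝ) (C B : ℝ) (hB : 0 ≤ B) (hσ : ∀ u, |σ u| ≤ C)
    (z : EuclideanSpace ℝ (Fin d')) (μ : Measure (Param d')) [IsProbabilityMeasure μ]
    (h : ∀ᵐ p ∂μ, |p.1| ≤ B) : |netF σ z μ| ≤ B * C := by
  unfold netF
  have := norm_integral_le_of_norm_le_const (μ := μ)
    (f := fun p : Param d' => p.1 * σ ⟪z, p.2⟫_ℝ) (C := B * C) (by
      filter_upwards [h] with p hp
      rw [Real.norm_eq_abs, abs_mul]
      exact mul_le_mul hp (hσ _) (abs_nonneg _) hB)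
  simpa using this

theorem aux_step {d' : ℕ} (n : ℕ) (σ : ℝ → ℝ) (C B : ℝ) (hB : 0 ≤ B)
    (hσ : ∀ u, |σ u| ≤ C)
    (x : Data d') (μ : Measure (Param d')) [IsProbabilityMeasure μ]
    (h : ∀ᵐ p ∂μ, |p.1| ≤ B) (θ : Param d') (hθ : |θ.1| ≤ B) :
    |(sgdStep n σ x μ θ).1| ≤ B + (n : ℝ)⁻¹ * ((|x.2| + B * C) * C) := by
  have hF := aux_netF σ C B hB hσ x.1 μ h
  have hg : |lossG σ x μ| ≤ |x.2| + B * C := by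
    unfold lossG
    exact (abs_sub _ _).trans (by linarith)
  have e : (sgdStep n σ x μ θ).1 = θ.1 + (n : ℝ)⁻¹ * (lossG σ x μ * σ ⟪x.1, θ.2⟫_ℝ) := by
    simp [sgdStep, gradA]
  rw [e]
  refine (abs_add_le _ _).trans (add_le_add hθ ?_)
  rw [abs_mul, abs_mul, abs_of_nonneg (by positivity : (0:ℝ) ≤ (n:ℝ)⁻¹)]
  refine mul_le_mul_of_nonneg_left ?_ (by positivity)
  exact mul_le_mul hg (hσ _) (abs_nonneg _) ((abs_nonneg _).trans hg)

/-- bound on the first coordinate of the SGD weight trajectory. -/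
theorem sgd_trajectory_c_bound {d' : ℕ} (hd' : 1 ≤ d') (σ : ℝ → ℝ)
    (Cσ Cν T : ℝ) (hCσ : 1 ≤ Cσ) (hCν : 1 ≤ Cν) (hT : 0 < T)
    (hσdiff : Differentiable ℝ σ) (hσbd : ∀ u, |σ u| ≤ Cσ) (hσ'bd : ∀ u, |deriv σ u| ≤ Cσ)
    (n K : ℕ) (hn : 1 ≤ n) (hK : (K : ℝ) ≤ n * T)
    (x : ℕ → Data d') (ν : ℕ → Measure (Param d'))
    (hν0 : IsProbabilityMeasure (ν 0))
    (hsupp : ∀ᵐ p ∂(ν 0), pnorm p ≤ Cν)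
    (hrec : ∀ k < K, ν (k + 1) = (ν k).map (sgdStep n σ (x (k + 1)) (ν k)))
    (θ : ℕ → Param d') (hθ0 : pnorm (θ 0) ≤ Cν)
    (hθ : ∀ k < K, θ (k + 1) = θ k + (n : ℝ)⁻¹ • gradA σ (x (k + 1)) (θ k) (ν k)) :
    ∀ k ≤ K, |(θ k).1| ≤
      2 * (1 + T) * Cσ ^ 3 * Real.exp (Cσ ^ 2 * T) *
        (Cν + (n : ℝ)⁻¹ * ∑ i ∈ Finset.Icc 1 K, |(x i).2|) := by
  set a : ℝ := (n : ℝ)⁻¹ with ha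
  have hn0 : (0 : ℝ) < n := by exact_mod_cast hn
  have ha0 : 0 < a := inv_pos.mpr hn0
  have hC0 : 0 < Cσ := by linarith
  let S : ℕ → ℝ := fun k => ∑ i ∈ Finset.Icc 1 k, |(x i).2|
  have hS0 : ∀ k, 0 ≤ S k := fun k => Finset.sum_nonneg fun i _ => abs_nonneg _
  let B : ℕ → ℝ := fun k => Real.exp (Cσ ^ 2 * a * k) * (Cν + Cσ * a * S k)
  have hB0 : ∀ k, 0 ≤ B k := fun k => by
    have := hS0 k
    simp only [B]
    positivity
  have hBstep : ∀ k, B k + a * ((|(x (k + 1)).2| + B k * Cσ) * Cσ) ≤ B (k + 1) := by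
    intro k
    have hS : S (k + 1) = S k + |(x (k + 1)).2| := by
      simp only [S]
      rw [Finset.sum_Icc_succ_top (by omega)]
    have hBe : B (k + 1) = Real.exp (Cσ ^ 2 * a) * B k
        + Real.exp (Cσ ^ 2 * a * (k + 1)) * (Cσ * a * |(x (k + 1)).2|) := by
      simp only [B]
      rw [hS]
      push_cast
      rw [mul_add (Cσ ^ 2 * a), mul_one, Real.exp_add]
      ring
    have h1 : Cσ ^ 2 * a + 1 ≤ Real.exp (Cσ ^ 2 * a) := Real.add_one_le_exp _
    have h2 : 1 ≤ Real.exp (Cσ ^ 2 * a * (k + 1)) := Real.one_le_exp (by positivity)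
    have h3 := mul_le_mul_of_nonneg_right h1 (hB0 k)
    have h4 := mul_le_mul_of_nonneg_right h2
      (by positivity : 0 ≤ Cσ * a * |(x (k + 1)).2|)
    rw [hBe]
    nlinarith [h3, h4]
  have key : ∀ k ≤ K, IsProbabilityMeasure (ν k) ∧ (∀ᵐ p ∂(ν k), |p.1| ≤ B k) ∧
      |(θ k).1| ≤ B k := by
    intro k
    induction k with
    | zero =>
      intro _
      have hB : B 0 = Cν := by simp [B, S]
      rw [hB]
      refine ⟨hν0, ?_, (aux_fst_le _).trans hθ0⟩
      filter_upwards [hsupp] with p hp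
      exact (aux_fst_le p).trans hp
    | succ k ih =>
      intro hk
      obtain ⟨h1, h2, h3⟩ := ih (by omega)
      have hm := aux_meas n σ hσdiff (x (k + 1)) (ν k)
      refine ⟨?_, ?_, ?_⟩
      · rw [hrec k hk]
        exact Measure.isProbabilityMeasure_map hm.aemeasurable
      · rw [hrec k hk, ae_map_iff hm.aemeasurable
          (measurableSet_le (measurable_fst.abs) measurable_const)]
        filter_upwards [h2] with p hp
        exact (aux_step n σ Cσ (B k) (hB0 k) hσbd _ _ h2 p hp).trans (hBstep k)
      · rw [hθ k hk]
        exact (aux_step n σ Cσ (B k) (hB0 k) hσbd _ _ h2 _ h3).trans (hBstep k)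
  intro k hk
  refine (key k hk).2.2.trans ?_
  have hSk : S k ≤ S K := by
    apply Finset.sum_le_sum_of_subset_of_nonneg
    · exact Finset.Icc_subset_Icc_right hk
    · intros; exact abs_nonneg _
  have hkT : a * k ≤ T := by
    have : (k : ℝ) ≤ n * T := le_trans (by exact_mod_cast hk) hK
    rw [ha, inv_mul_le_iff₀ hn0]
    exact this
  have hexp : Real.exp (Cσ ^ 2 * a * k) ≤ Real.exp (Cσ ^ 2 * T) := by
    apply Real.exp_le_exp.mpr
    rw [mul_assoc]
    exact mul_le_mul_of_nonneg_left hkT (by positivity)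
  have hSK := hS0 K
  have hX0 : 0 ≤ Cν + a * S K := by positivity
  have hin : Cν + Cσ * a * S k ≤ Cσ * (Cν + a * S K) := by
    have := mul_le_mul_of_nonneg_left hSk (by positivity : 0 ≤ Cσ * a)
    nlinarith
  have hc : Cσ ≤ 2 * (1 + T) * Cσ ^ 3 := by
    have h1 : Cσ ≤ Cσ ^ 3 := le_self_pow₀ hCσ (by norm_num)
    nlinarith [pow_pos hC0 3, mul_pos hT (pow_pos hC0 3)]
  change Real.exp (Cσ ^ 2 * a * k) * (Cν + Cσ * a * S k) ≤
    2 * (1 + T) * Cσ ^ 3 * Real.exp (Cσ ^ 2 * T) * (Cν + a * S K)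
  have hk0 := hS0 k
  calc Real.exp (Cσ ^ 2 * a * k) * (Cν + Cσ * a * S k)
      ≤ Real.exp (Cσ ^ 2 * T) * (Cσ * (Cν + a * S K)) :=
        mul_le_mul hexp hin (by positivity) (Real.exp_pos _).le
    _ = Cσ * (Real.exp (Cσ ^ 2 * T) * (Cν + a * S K)) := by ring
    _ ≤ (2 * (1 + T) * Cσ ^ 3) * (Real.exp (Cσ ^ 2 * T) * (Cν + a * S K)) :=
        mul_le_mul_of_nonneg_right hc (by positivity)
    _ = _ := by ring
end
end

section
/- Let T > 0 and let (κ_t)_{t∈[0,T]} be a Markov kernel from [0,T] to ℝ^d, and let ρ be the finite measure on [0,T]×ℝ^d given by ρ(dt,dx) = dt ⊗ κ_t(dx) (Lebesgue measure on [0,T] composed with the kernel κ). For each n ≥ 1, let ρ^n be the finite measure on [0,T]×ℝ^d given by ρ^n(ds,dx) = ds ⊗ κ^n_s(dx), where for s ∈ [(k−1)/n, k/n) with 1 ≤ k ≤ ⌊nT⌋, κ^n_s(B) := n·∫_{(k−1)/n}^{k/n} κ_t(B) dt for Borel sets B ⊆ ℝ^d, and κ^n_s := 0 for s ≥ ⌊nT⌋/n.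 Then the sequence (ρ^n)_{n≥1} converges weakly to ρ as finite measures on [0,T]×ℝ^d, i.e., ∫ f dρ^n → ∫ f dρ for every bounded continuous f : [0,T]×ℝ^d → ℝ. -/
open MeasureTheory ProbabilityTheory Set Filter
open scoped ENNReal NNReal Topology

noncomputable section

/-- The piecewise-averaged measure `ρ^n(ds,dx) = ds ⊗ κ^n_s(dx)` where, on each interval
`[(k−1)/n, k/n)` with `1 ≤ k ≤ ⌊nT⌋`, the kernel `κ^n_s := n·∫_{(k−1)/n}^{k/n} κ_t dt` is
constant, and `κ^n_s := 0` for `s ≥ ⌊nT⌋/n`. -/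
def avgMeas {X : Type*} [MeasurableSpace X] (T : ℝ) (κ : Kernel ℝ X) (n : ℕ) :
    Measure (ℝ × X) :=
  ∑ k ∈ Finset.Icc 1 ⌊(n : ℝ) * T⌋₊,
    (volume.restrict (Set.Ico (((k : ℝ) - 1) / n) ((k : ℝ) / n))).prod
      ((n : ℝ≥0∞) •
        (volume.restrict (Set.Icc (((k : ℝ) - 1) / n) ((k : ℝ) / n))).bind (fun t => κ t))

lemma avg_aux_sm (d : ℕ) (f : BoundedContinuousFunction (ℝ × EuclideanSpace ℝ (Fin d)) ℝ)
    (a b : ℝ) : StronglyMeasurable (fun x => ∫ s in Set.Ico a b, f (s, x)) := by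
  have h : StronglyMeasurable (fun q : EuclideanSpace ℝ (Fin d) × ℝ => f (q.2, q.1)) :=
    (f.continuous.comp (continuous_snd.prodMk continuous_fst)).stronglyMeasurable
  exact h.integral_prod_right' (ν := volume.restrict (Set.Ico a b))

lemma avg_aux_bound (d : ℕ) (f : BoundedContinuousFunction (ℝ × EuclideanSpace ℝ (Fin d)) ℝ)
    (a b : ℝ) (hab : a ≤ b) (x : EuclideanSpace ℝ (Fin d)) (c C : ℝ)
    (h : ∀ s ∈ Set.Ico a b, ‖f (s, x) - c‖ ≤ C) :
    ‖(∫ s in Set.Ico a b, f (s, x)) - (b - a) * c‖ ≤ C * (b - a) := by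
  have hv : (volume (Set.Ico a b)).toReal = b - a := by
    rw [Real.volume_Ico, ENNReal.toReal_ofReal (by linarith)]
  have hi : IntegrableOn (fun s => f (s, x)) (Set.Ico a b) := by
    have hc : Continuous (fun s => f (s, x)) := by fun_prop
    exact (hc.integrableOn_Icc (a := a) (b := b)).mono_set Ico_subset_Icc_self
  have e : (∫ s in Set.Ico a b, f (s, x)) - (b - a) * c
      = ∫ s in Set.Ico a b, (f (s, x) - c) := by
    rw [integral_sub hi (by simp)]
    rw [setIntegral_const, measureReal_def, hv, smul_eq_mul]
  rw [e]
  have := norm_setIntegral_le_of_norm_le_const (μ := volume) (s := Set.Ico a b)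
    (by simp) h
  rwa [measureReal_def, hv] at this

lemma avg_aux_step (d : ℕ) (T : ℝ)
    (κ : Kernel ℝ (EuclideanSpace ℝ (Fin d))) [IsMarkovKernel κ]
    (f : BoundedContinuousFunction (ℝ × EuclideanSpace ℝ (Fin d)) ℝ) (n : ℕ) (a b : ℝ)
    (ha : 0 ≤ a) (hab : a ≤ b) (hb : b ≤ T) :
    ∫ p, f p ∂((volume.restrict (Set.Ico a b)).prod
      ((n : ℝ≥0∞) • (volume.restrict (Set.Icc a b)).bind (fun t => κ t))) =
    ∫ p in Set.Ico a b ×ˢ univ, (n * ∫ s in Set.Ico a b, f (s, p.2))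
      ∂((volume.restrict (Set.Icc 0 T)) ⊗ₘ κ) := by
  have hr : volume.restrict (Set.Icc a b) = volume.restrict (Set.Ico a b) :=
    (Measure.restrict_congr_set Ico_ae_eq_Icc).symm
  rw [hr]
  have hm := avg_aux_sm d f a b
  have hbd : ∀ x, ‖∫ s in Set.Ico a b, f (s, x)‖ ≤ ‖f‖ * (b - a) := by
    intro x
    simpa using avg_aux_bound d f a b hab x 0 ‖f‖ (by
      intro s _; simpa using f.norm_coe_le_norm (s, x))
  have : IsFiniteMeasure ((n : ℝ≥0∞) • (volume.restrict (Set.Ico a b)).bind κ) :=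
    Measure.smul_finite _ (by simp)
  have hI : ∫ x, (∫ s in Set.Ico a b, f (s, x)) ∂((volume.restrict (Set.Ico a b)).bind κ) =
      ∫ t in Set.Ico a b, ∫ x, (∫ s in Set.Ico a b, f (s, x)) ∂(κ t) := by
    rw [← Measure.snd_compProd, Measure.snd, integral_map measurable_snd.aemeasurable
      hm.aestronglyMeasurable, Measure.integral_compProd]
    exact Integrable.of_bound (hm.comp_measurable measurable_snd).aestronglyMeasurable _
      (ae_of_all _ fun p => hbd p.2)
  rw [integral_prod_symm _ (f.integrable _), integral_smul_measure, hI,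
    Measure.setIntegral_compProd (by measurability) MeasurableSet.univ]
  · simp only [Measure.restrict_univ, integral_const_mul]
    rw [Measure.restrict_restrict measurableSet_Ico, inter_eq_left.2]
    · simp
    · exact fun x hx => ⟨ha.trans hx.1, hx.2.le.trans hb⟩
  · apply Integrable.integrableOn
    apply Integrable.const_mul
    exact Integrable.of_bound (hm.comp_measurable measurable_snd).aestronglyMeasurable _
      (ae_of_all _ fun p => hbd p.2)

/-- The averaged function. -/
def avgG (d : ℕ) (T : ℝ) (f : BoundedContinuousFunction (ℝ × EuclideanSpace ℝ (Fin d)) ℝ)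
    (n : ℕ) (p : ℝ × EuclideanSpace ℝ (Fin d)) : ℝ :=
  ∑ k ∈ Finset.Icc 1 ⌊(n : ℝ) * T⌋₊,
    (Set.Ico (((k : ℝ) - 1) / n) ((k : ℝ) / n) ×ˢ univ).indicator
      (fun p => n * ∫ s in Set.Ico (((k : ℝ) - 1) / n) ((k : ℝ) / n), f (s, p.2)) p

lemma avgG_eq (d : ℕ) (T : ℝ) (f : BoundedContinuousFunction (ℝ × EuclideanSpace ℝ (Fin d)) ℝ)
    (n : ℕ) (hn : 0 < n) (p : ℝ × EuclideanSpace ℝ (Fin d)) (j : ℕ)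
    (hj : j ∈ Finset.Icc 1 ⌊(n : ℝ) * T⌋₊)
    (hp : p.1 ∈ Set.Ico (((j : ℝ) - 1) / n) ((j : ℝ) / n)) :
    avgG d T f n p = n * ∫ s in Set.Ico (((j : ℝ) - 1) / n) ((j : ℝ) / n), f (s, p.2) := by
  have hn' : (0 : ℝ) < n := by exact_mod_cast hn
  unfold avgG
  rw [Finset.sum_eq_single_of_mem j hj]
  · rw [indicator_of_mem (by exact ⟨hp, mem_univ _⟩)]
  · intro k _ hkj
    apply indicator_of_notMem
    rintro ⟨hk, -⟩
    apply hkj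
    rw [mem_Ico, div_le_iff₀ hn', lt_div_iff₀ hn'] at hk hp
    have h1 : (k : ℝ) < j + 1 := by linarith
    have h2 : (j : ℝ) < k + 1 := by linarith
    norm_cast at h1 h2
    omega

lemma avgG_close (d : ℕ) (T : ℝ)
    (f : BoundedContinuousFunction (ℝ × EuclideanSpace ℝ (Fin d)) ℝ)
    (n : ℕ) (hn : 0 < n) (p : ℝ × EuclideanSpace ℝ (Fin d)) (j : ℕ)
    (hj : j ∈ Finset.Icc 1 ⌊(n : ℝ) * T⌋₊)
    (hp : p.1 ∈ Set.Ico (((j : ℝ) - 1) / n) ((j : ℝ) / n)) (c C : ℝ)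
    (h : ∀ s ∈ Set.Ico (((j : ℝ) - 1) / n) ((j : ℝ) / n), ‖f (s, p.2) - c‖ ≤ C) :
    ‖avgG d T f n p - c‖ ≤ C := by
  have hn' : (0 : ℝ) < n := by exact_mod_cast hn
  rw [avgG_eq d T f n hn p j hj hp]
  have hw : (j : ℝ) / n - ((j : ℝ) - 1) / n = 1 / n := by field_simp; ring
  have := avg_aux_bound d f _ _ (by rw [← sub_nonneg, hw]; positivity) p.2 c C h
  rw [hw] at this
  set I := ∫ s in Set.Ico (((j : ℝ) - 1) / n) ((j : ℝ) / n), f (s, p.2)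
  have e : n * I - c = n * (I - 1 / n * c) := by field_simp
  rw [e, norm_mul, Real.norm_natCast]
  calc (n : ℝ) * ‖I - 1 / n * c‖ ≤ n * (C * (1 / n)) := by gcongr
    _ = C := by field_simp

lemma avgG_norm_le (d : ℕ) (T : ℝ)
    (f : BoundedContinuousFunction (ℝ × EuclideanSpace ℝ (Fin d)) ℝ)
    (n : ℕ) (hn : 0 < n) (p : ℝ × EuclideanSpace ℝ (Fin d)) : ‖avgG d T f n p‖ ≤ ‖f‖ := by
  by_cases h : ∃ j ∈ Finset.Icc 1 ⌊(n : ℝ) * T⌋₊, p.1 ∈ Set.Ico (((j : ℝ) - 1) / n) ((j : ℝ) / n)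
  · obtain ⟨j, hj, hp⟩ := h
    simpa using avgG_close d T f n hn p j hj hp 0 ‖f‖ (by
      intro s _; simpa using f.norm_coe_le_norm (s, p.2))
  · push Not at h
    unfold avgG
    rw [Finset.sum_eq_zero]
    · simp
    · intro k hk
      exact indicator_of_notMem (fun hh => h k hk hh.1) _

lemma avgG_sm (d : ℕ) (T : ℝ)
    (f : BoundedContinuousFunction (ℝ × EuclideanSpace ℝ (Fin d)) ℝ)
    (n k : ℕ) : StronglyMeasurable (fun p : ℝ × EuclideanSpace ℝ (Fin d) =>
     (Set.Ico (((k : ℝ) - 1) / n) ((k : ℝ) / n) ×ˢ univ).indicator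
      (fun p : ℝ × EuclideanSpace ℝ (Fin d) =>
        (n : ℝ) * ∫ s in Set.Ico (((k : ℝ) - 1) / n) ((k : ℝ) / n), f (s, p.2)) p) := by
  apply StronglyMeasurable.indicator
  · exact ((avg_aux_sm d f _ _).comp_measurable measurable_snd).const_mul _
  · exact measurableSet_Ico.prod MeasurableSet.univ

lemma avgG_tendsto (d : ℕ) (T : ℝ)
    (f : BoundedContinuousFunction (ℝ × EuclideanSpace ℝ (Fin d)) ℝ)
    (p : ℝ × EuclideanSpace ℝ (Fin d)) (h0 : 0 ≤ p.1) (h1 : p.1 < T) :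
    Tendsto (fun n => avgG d T f n p) atTop (𝓝 (f p)) := by
  rw [Metric.tendsto_atTop]
  intro ε hε
  have hc : Continuous (fun s => f (s, p.2)) := by fun_prop
  obtain ⟨δ, hδ, H⟩ := Metric.continuous_iff.1 hc p.1 (ε / 2) (by positivity)
  obtain ⟨N1, hN1⟩ := exists_nat_gt (1 / δ)
  obtain ⟨N2, hN2⟩ := exists_nat_gt (1 / (T - p.1))
  refine ⟨N1 + N2 + 1, fun n hn => ?_⟩
  have hTp : 0 < T - p.1 := by linarith
  have hn0 : 0 < n := by omega
  have hn' : (0 : ℝ) < n := by exact_mod_cast hn0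
  have hnR : (N1 : ℝ) + N2 + 1 ≤ n := by exact_mod_cast hn
  have hN1' : (0 : ℝ) ≤ N1 := by positivity
  have hN2' : (0 : ℝ) ≤ N2 := by positivity
  rw [div_lt_iff₀ hδ] at hN1
  rw [div_lt_iff₀ hTp] at hN2
  have e1 : 1 < n * δ := by nlinarith
  have e2 : 1 < n * (T - p.1) := by nlinarith
  have f1 := Nat.floor_le (show 0 ≤ n * p.1 by positivity)
  have f2 := Nat.lt_floor_add_one (n * p.1)
  rw [Real.dist_eq]
  refine lt_of_le_of_lt ?_ (half_lt_self hε)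
  refine avgG_close d T f n hn0 p (⌊n * p.1⌋₊ + 1) ?_ ?_ _ _ ?_
  · rw [Finset.mem_Icc]
    refine ⟨by omega, Nat.le_floor ?_⟩
    push_cast
    nlinarith
  · rw [mem_Ico, div_le_iff₀ hn', lt_div_iff₀ hn']
    push_cast
    constructor <;> linarith
  · intro s hs
    rw [mem_Ico, div_le_iff₀ hn', lt_div_iff₀ hn'] at hs
    push_cast at hs
    have := H s (by
      rw [Real.dist_eq, abs_lt]
      constructor <;> nlinarith)
    exact this.le

lemma avgG_integral (d : ℕ) (T : ℝ) (hT : 0 < T)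
    (κ : Kernel ℝ (EuclideanSpace ℝ (Fin d))) [IsMarkovKernel κ]
    (f : BoundedContinuousFunction (ℝ × EuclideanSpace ℝ (Fin d)) ℝ) (n : ℕ) (hn : 0 < n) :
    ∫ p, f p ∂(avgMeas T κ n) =
      ∫ p, avgG d T f n p ∂((volume.restrict (Set.Icc 0 T)) ⊗ₘ κ) := by
  have hn' : (0 : ℝ) < n := by exact_mod_cast hn
  have hw : ∀ k : ℕ, (k : ℝ) / n - ((k : ℝ) - 1) / n = 1 / n := by
    intro k; field_simp; ring
  have hle : ∀ k : ℕ, ((k : ℝ) - 1) / n ≤ k / n := by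
    intro k; rw [← sub_nonneg, hw]; positivity
  unfold avgMeas avgG
  rw [integral_finsetSum_measure, integral_finsetSum]
  · refine Finset.sum_congr rfl fun k hk => ?_
    rw [Finset.mem_Icc] at hk
    have hk1 : (1 : ℝ) ≤ k := by exact_mod_cast hk.1
    have hk2 : (k : ℝ) ≤ n * T := (Nat.le_floor_iff (by positivity)).1 hk.2
    rw [avg_aux_step d T κ f n _ _ (div_nonneg (by linarith) hn'.le) (hle k)
      (by rw [div_le_iff₀ hn']; linarith),
      integral_indicator (measurableSet_Ico.prod MeasurableSet.univ)]
  · intro k hk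
    refine Integrable.of_bound (avgG_sm d T f n k).aestronglyMeasurable
      (n * (‖f‖ * (1 / n))) (ae_of_all _ fun p => ?_)
    refine (norm_indicator_le_norm_self _ _).trans ?_
    rw [norm_mul, Real.norm_natCast]
    gcongr
    have := avg_aux_bound d f _ _ (hle k) p.2 0 ‖f‖ (by
      intro s _; simpa using f.norm_coe_le_norm (s, p.2))
    rw [hw k] at this
    simpa using this
  · intro k hk
    have : IsFiniteMeasure ((n : ℝ≥0∞) •
        (volume.restrict (Set.Icc (((k : ℝ) - 1) / n) ((k : ℝ) / n))).bind κ) :=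
      Measure.smul_finite _ (by simp)
    exact f.integrable _

theorem avgMeas_tendsto_weakly (d : ℕ) (T : ℝ) (hT : 0 < T)
    (κ : Kernel ℝ (EuclideanSpace ℝ (Fin d))) [IsMarkovKernel κ]
    (f : BoundedContinuousFunction (ℝ × EuclideanSpace ℝ (Fin d)) ℝ) :
    Tendsto (fun n : ℕ => ∫ p, f p ∂(avgMeas T κ n)) atTop
      (𝓝 (∫ p, f p ∂((volume.restrict (Set.Icc 0 T)) ⊗ₘ κ))) := by
  have key : Tendsto (fun n : ℕ => ∫ p, avgG d T f n p ∂((volume.restrict (Set.Icc 0 T)) ⊗ₘ κ))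
      atTop (𝓝 (∫ p, f p ∂((volume.restrict (Set.Icc 0 T)) ⊗ₘ κ))) := by
    refine tendsto_integral_filter_of_dominated_convergence (fun _ => ‖f‖) ?_ ?_ ?_ ?_
    · refine Eventually.of_forall fun n => StronglyMeasurable.aestronglyMeasurable ?_
      unfold avgG
      exact Finset.stronglyMeasurable_fun_sum _ fun k _ => avgG_sm d T f n k
    · filter_upwards [eventually_gt_atTop 0] with n hn
      exact ae_of_all _ fun p => avgG_norm_le d T f n hn p
    · exact integrable_const _
    · have hS : MeasurableSet {p : ℝ × EuclideanSpace ℝ (Fin d) | 0 ≤ p.1 ∧ p.1 < T} :=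
        (measurableSet_Ico (a := (0:ℝ)) (b := T)).preimage measurable_fst
      have : ∀ᵐ p ∂((volume.restrict (Set.Icc 0 T)) ⊗ₘ κ), 0 ≤ p.1 ∧ p.1 < T := by
        rw [Measure.ae_compProd_iff hS, ← Measure.restrict_congr_set Ico_ae_eq_Icc]
        filter_upwards [ae_restrict_mem measurableSet_Ico] with t ht
        exact ae_of_all _ fun _ => ht
      filter_upwards [this] with p hp
      exact avgG_tendsto d T f p hp.1 hp.2
  refine key.congr' ?_
  filter_upwards [eventually_gt_atTop 0] with n hn
  exact (avgG_integral d T hT κ f n hn).symm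
end
end

section
/- Let T > 0, let π be a Borel probability measure on ℝ^d, let (κ_t)_{t∈[0,T]} be a Markov kernel from [0,T] to ℝ^d, and let ρ(dt,dx) = dt ⊗ κ_t(dx) on [0,T]×ℝ^d. For each n ≥ 1 define ρ^n(ds,dx) = ds ⊗ κ^n_s(dx), where for s ∈ [(k−1)/n, k/n) with 1 ≤ k ≤ ⌊nT⌋, κ^n_s(B) := n·∫_{(k−1)/n}^{k/n} κ_t(B) dt, and κ^n_s := 0 for s ≥ ⌊nT⌋/n. Let π_T denote the product of Lebesgue measure on [0,T] with π. Then for every n ≥ 1 one has H(ρ^n | π_T) ≤ H(ρ | π_T). -/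
open MeasureTheory ProbabilityTheory Set Filter
open scoped ENNReal NNReal Topology

noncomputable section

open scoped Classical in
/-- The relative entropy `H(μ|ν) = ∫ log(dμ/dν) dμ` if `μ ≪ ν` (with integrable
log-likelihood ratio), and `+∞` otherwise; valued in `[0,∞]`. -/
def relEnt {α : Type*} [MeasurableSpace α] (μ ν : Measure α) : ℝ≥0∞ :=
  if μ ≪ ν ∧ Integrable (llr μ ν) μ then ENNReal.ofReal (∫ x, llr μ ν x ∂μ) else ⊤

section Helpers
open InformationTheory in
lemma klDiv_restrict_le' {α : Type*} [MeasurableSpace α] (μ ν : Measure α)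
    [IsFiniteMeasure μ] [IsFiniteMeasure ν] {S : Set α} (hS : MeasurableSet S) :
    klDiv (μ.restrict S) (ν.restrict S) ≤ klDiv μ ν := by
  by_cases h : μ ≪ ν
  swap
  · simp [h]
  have hm := Measure.measurable_rnDeriv μ ν
  have e : μ.restrict S = (ν.restrict S).withDensity (μ.rnDeriv ν) := by
    rw [← restrict_withDensity hS, Measure.withDensity_rnDeriv_eq _ _ h]
  have hd : (μ.restrict S).rnDeriv (ν.restrict S) =ᵐ[ν.restrict S] μ.rnDeriv ν := by
    rw [e]; exact Measure.rnDeriv_withDensity _ hm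
  rw [klDiv_eq_lintegral_klFun_of_ac h, klDiv_eq_lintegral_klFun_of_ac (h.restrict S)]
  calc _ = ∫⁻ x in S, ENNReal.ofReal (klFun (μ.rnDeriv ν x).toReal) ∂ν := by
        apply lintegral_congr_ae
        filter_upwards [hd] with x hx
        rw [hx]
    _ ≤ _ := setLIntegral_le_lintegral _ _

lemma rnDeriv_restrict_right' {α : Type*} [MeasurableSpace α] (μ ν : Measure α)
    [IsFiniteMeasure μ] [IsFiniteMeasure ν] {S : Set α} (hS : MeasurableSet S)
    (h : μ ≪ ν.restrict S) :
    μ.rnDeriv ν =ᵐ[ν.restrict S] μ.rnDeriv (ν.restrict S) := by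
  have hm := Measure.measurable_rnDeriv μ (ν.restrict S)
  have e : μ = ν.withDensity (S.indicator (μ.rnDeriv (ν.restrict S))) := by
    rw [withDensity_indicator hS, Measure.withDensity_rnDeriv_eq _ _ h]
  have hd : μ.rnDeriv ν =ᵐ[ν] S.indicator (μ.rnDeriv (ν.restrict S)) := by
    conv_lhs => rw [e]
    exact Measure.rnDeriv_withDensity _ (hm.indicator hS)
  filter_upwards [ae_restrict_of_ae hd, ae_restrict_mem hS] with x hx hxS
  rw [hx, indicator_of_mem hxS]

/-- the `k`-th block -/
def blk (n k : ℕ) : Set ℝ := Set.Ico (((k : ℝ) - 1) / n) ((k : ℝ) / n)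

/-- union of blocks -/
def blks (n N : ℕ) : Set ℝ := ⋃ k ∈ Finset.Icc 1 N, blk n k

lemma measurableSet_blk (n k : ℕ) : MeasurableSet (blk n k) := measurableSet_Ico

lemma measurableSet_blks (n N : ℕ) : MeasurableSet (blks n N) :=
  Finset.measurableSet_biUnion _ fun _ _ => measurableSet_blk _ _

lemma floor_of_mem_blk {n k : ℕ} (hn : 1 ≤ n) (hk : 1 ≤ k) {t : ℝ} (ht : t ∈ blk n k) :
    ⌊(n : ℝ) * t⌋₊ + 1 = k := by
  have hn' : (0 : ℝ) < n := by exact_mod_cast hn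
  obtain ⟨h1, h2⟩ := ht
  rw [div_le_iff₀ hn'] at h1
  rw [lt_div_iff₀ hn'] at h2
  obtain ⟨j, rfl⟩ : ∃ j, k = j + 1 := ⟨k - 1, by omega⟩
  push_cast at h1 h2
  congr 1
  rw [Nat.floor_eq_iff (by nlinarith [Nat.cast_nonneg (α := ℝ) j])]
  constructor <;> linarith

lemma disj_blk {n : ℕ} (hn : 1 ≤ n) (N : ℕ) :
    (↑(Finset.Icc 1 N) : Set ℕ).PairwiseDisjoint (blk n) := by
  intro a ha b hb hab
  rw [Function.onFun, Set.disjoint_left]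
  intro t hta htb
  simp only [Finset.coe_Icc, Set.mem_Icc] at ha hb
  exact hab ((floor_of_mem_blk hn ha.1 hta).symm.trans (floor_of_mem_blk hn hb.1 htb))

lemma volume_blk {n : ℕ} (hn : 1 ≤ n) (k : ℕ) : (n : ℝ≥0∞) * volume (blk n k) = 1 := by
  have hn' : (0 : ℝ) < n := by exact_mod_cast hn
  have : (k : ℝ) / n - ((k : ℝ) - 1) / n = (n : ℝ)⁻¹ := by field_simp; ring
  rw [blk, Real.volume_Ico, this, ENNReal.ofReal_inv_of_pos hn', ENNReal.ofReal_natCast]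
  exact ENNReal.mul_inv_cancel (by simp; omega) (by simp)

lemma blks_subset {n : ℕ} (hn : 1 ≤ n) {T : ℝ} (hT : 0 < T) :
    blks n ⌊(n : ℝ) * T⌋₊ ⊆ Set.Icc 0 T := by
  have hn' : (0 : ℝ) < n := by exact_mod_cast hn
  intro t ht
  simp only [blks, Set.mem_iUnion, Finset.mem_Icc, exists_prop] at ht
  obtain ⟨k, ⟨hk1, hk2⟩, h1, h2⟩ := ht
  have hk2' := (Nat.le_floor_iff (by positivity)).1 hk2
  have hk1' : (1 : ℝ) ≤ k := by exact_mod_cast hk1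
  rw [div_le_iff₀ hn'] at h1
  rw [lt_div_iff₀ hn'] at h2
  constructor
  · by_contra! h; nlinarith
  · by_contra! h; nlinarith

/-- uniform distribution on the block of `t` -/
def unifKer (n : ℕ) : Kernel ℝ ℝ :=
  (Kernel.ofFunOfCountable (fun j : ℕ => (n : ℝ≥0∞) • volume.restrict (blk n (j + 1)))).comap
    (fun t : ℝ => ⌊(n : ℝ) * t⌋₊) (Nat.measurable_floor.comp (measurable_const.mul measurable_id))

lemma unifKer_apply (n : ℕ) (t : ℝ) :
    unifKer n t = (n : ℝ≥0∞) • volume.restrict (blk n (⌊(n : ℝ) * t⌋₊ + 1)) := rfl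

lemma isMarkov_unifKer {n : ℕ} (hn : 1 ≤ n) : IsMarkovKernel (unifKer n) := by
  refine ⟨fun t => ⟨?_⟩⟩
  rw [unifKer_apply]
  simp [volume_blk hn]

variable {X : Type*} [MeasurableSpace X]

lemma avgMeas_apply_prod (T : ℝ) (κ : Kernel ℝ X) [IsMarkovKernel κ] (n : ℕ)
    {s : Set ℝ} {C : Set X} (hC : MeasurableSet C) :
    avgMeas T κ n (s ×ˢ C) = ∑ k ∈ Finset.Icc 1 ⌊(n : ℝ) * T⌋₊,
      volume.restrict (blk n k) s * (n * ∫⁻ t in blk n k, κ t C) := by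
  rw [avgMeas, Measure.finsetSum_apply]
  refine Finset.sum_congr rfl fun k _ => ?_
  have : SFinite ((volume.restrict (Set.Icc (((k : ℝ) - 1) / n) ((k : ℝ) / n))).bind (fun t => κ t)) :=
    inferInstanceAs (SFinite (κ ∘ₘ _))
  rw [Measure.prod_prod, Measure.smul_apply, Measure.bind_apply hC κ.aemeasurable, smul_eq_mul,
    ← restrict_Ico_eq_restrict_Icc]
  rfl

lemma comp_eq_avgMeas {n : ℕ} (hn : 1 ≤ n) (T : ℝ) (κ : Kernel ℝ X) [IsMarkovKernel κ]
    [IsFiniteMeasure (volume.restrict (blks n ⌊(n : ℝ) * T⌋₊))] :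
    (unifKer n ∥ₖ (Kernel.id : Kernel X X)) ∘ₘ
      ((volume.restrict (blks n ⌊(n : ℝ) * T⌋₊)) ⊗ₘ κ) = avgMeas T κ n := by
  have := isMarkov_unifKer hn
  apply Measure.ext_prod
  intro s C hs hC
  rw [avgMeas_apply_prod T κ n hC, Measure.bind_apply (hs.prod hC) (Kernel.aemeasurable _),
    Measure.lintegral_compProd (Kernel.measurable_coe _ (hs.prod hC)), blks,
    lintegral_biUnion_finset (disj_blk hn _) (fun _ _ => measurableSet_blk _ _)]
  refine Finset.sum_congr rfl fun k hk => ?_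
  rw [← mul_assoc, ← lintegral_const_mul _ (Kernel.measurable_coe _ hC)]
  refine setLIntegral_congr_fun (measurableSet_blk _ _) fun t ht => ?_
  simp only [Kernel.parallelComp_apply_prod]
  rw [lintegral_const_mul _ (Kernel.measurable_coe _ hC), unifKer_apply,
    floor_of_mem_blk hn (Finset.mem_Icc.1 hk).1 ht]
  simp only [Kernel.id_apply, Measure.smul_apply, smul_eq_mul]
  simp_rw [Measure.dirac_apply' _ hC]
  rw [lintegral_indicator_one hC, mul_comm (n : ℝ≥0∞)]

lemma avgMeas_const {n : ℕ} (hn : 1 ≤ n) (T : ℝ) (π : Measure X) [IsProbabilityMeasure π]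
    [IsFiniteMeasure (volume.restrict (blks n ⌊(n : ℝ) * T⌋₊))] :
    avgMeas T (Kernel.const ℝ π) n =
      (volume.restrict (blks n ⌊(n : ℝ) * T⌋₊)).prod π := by
  symm
  apply Measure.ext_prod
  intro s C hs hC
  rw [avgMeas_apply_prod T _ n hC, Measure.prod_prod, Measure.restrict_apply hs, blks]
  rw [Set.inter_iUnion₂, measure_biUnion_finset, Finset.sum_mul]
  · refine Finset.sum_congr rfl fun k hk => ?_
    simp only [Kernel.const_apply, lintegral_const, Measure.restrict_apply MeasurableSet.univ,
      Set.univ_inter, Measure.restrict_apply hs]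
    rw [mul_left_comm (n : ℝ≥0∞), volume_blk hn, mul_one]
  · exact (disj_blk hn _).mono fun _ => Set.inter_subset_right
  · exact fun k _ => hs.inter (measurableSet_blk _ _)

lemma restrict_compProd' (μ : Measure ℝ) [IsFiniteMeasure μ] (κ : Kernel ℝ X) [IsMarkovKernel κ]
    {B : Set ℝ} (hB : MeasurableSet B) :
    (μ ⊗ₘ κ).restrict (B ×ˢ Set.univ) = (μ.restrict B) ⊗ₘ κ := by
  apply Measure.ext_prod
  intro s C hs hC
  rw [Measure.restrict_apply (hs.prod hC), Set.prod_inter_prod, Set.inter_univ,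
    Measure.compProd_apply_prod (hs.inter hB) hC, Measure.compProd_apply_prod hs hC,
    Measure.restrict_restrict hs]

end Helpers

/-- the relative entropy of the piecewise-averaged measure `ρ^n` with respect
to `π_T = dt ⊗ π` is bounded by the relative entropy of `ρ = dt ⊗ κ_t`. -/
theorem avgMeas_relEnt_le (d : ℕ) (T : ℝ) (hT : 0 < T)
    (κ : Kernel ℝ (EuclideanSpace ℝ (Fin d))) [IsMarkovKernel κ]
    (π : Measure (EuclideanSpace ℝ (Fin d))) [IsProbabilityMeasure π]
    (n : ℕ) (hn : 1 ≤ n) :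
    relEnt (avgMeas T κ n) ((volume.restrict (Set.Icc 0 T)).prod π) ≤
      relEnt ((volume.restrict (Set.Icc 0 T)) ⊗ₘ κ)
        ((volume.restrict (Set.Icc 0 T)).prod π) := by
  set N := ⌊(n : ℝ) * T⌋₊ with hN
  set lam := volume.restrict (Set.Icc 0 T) with hlam
  set B := blks n N with hBdef
  have hB : MeasurableSet B := measurableSet_blks _ _
  have hsub : B ⊆ Set.Icc 0 T := blks_subset hn hT
  have hlB : lam.restrict B = volume.restrict B := by
    rw [hlam, Measure.restrict_restrict hB, Set.inter_eq_left.2 hsub]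
  have hfin : IsFiniteMeasure (volume.restrict B) := by rw [← hlB]; infer_instance
  have hmk := isMarkov_unifKer hn
  have e1 := comp_eq_avgMeas hn T κ
  have e2 := (comp_eq_avgMeas hn T (Kernel.const ℝ π)).trans (avgMeas_const hn T π)
  have hfinA : IsFiniteMeasure (avgMeas T κ n) := by rw [← e1]; infer_instance
  set S : Set (ℝ × EuclideanSpace ℝ (Fin d)) := B ×ˢ Set.univ with hSdef
  have hS : MeasurableSet S := hB.prod MeasurableSet.univ
  have r1 := restrict_compProd' lam κ hB
  have r2 := restrict_compProd' lam (Kernel.const ℝ π) hB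
  rw [Measure.compProd_const, Measure.compProd_const] at r2
  rw [hlB] at r1 r2
  have key : InformationTheory.klDiv (avgMeas T κ n) ((lam.prod π).restrict S) ≤
      InformationTheory.klDiv (lam ⊗ₘ κ) (lam.prod π) := by
    refine le_trans ?_ (klDiv_restrict_le' _ _ hS)
    rw [r1, r2]
    have := InformationTheory.klDiv_comp_right_le (volume.restrict B ⊗ₘ κ)
      (volume.restrict B ⊗ₘ (Kernel.const ℝ π))
      (unifKer n ∥ₖ (Kernel.id : Kernel (EuclideanSpace ℝ (Fin d)) _))
    rw [e1, e2, Measure.compProd_const] at this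
    exact this
  have mass1 : (lam ⊗ₘ κ).real Set.univ = (lam.prod π).real Set.univ := by
    rw [measureReal_def, measureReal_def, Measure.compProd_apply_univ, ← Set.univ_prod_univ,
      Measure.prod_prod, measure_univ (μ := π), mul_one]
  have mass2 : (avgMeas T κ n).real Set.univ = ((lam.prod π).restrict S).real Set.univ := by
    rw [r2, ← e1, measureReal_def, measureReal_def, Measure.bind_apply MeasurableSet.univ
      (Kernel.aemeasurable _)]
    simp only [measure_univ, lintegral_one]
    rw [Measure.compProd_apply_univ, ← Set.univ_prod_univ,
      Measure.prod_prod, measure_univ (μ := π), mul_one]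
  by_cases h : (lam ⊗ₘ κ) ≪ lam.prod π ∧ Integrable (llr (lam ⊗ₘ κ) (lam.prod π)) (lam ⊗ₘ κ)
  swap
  · rw [relEnt.eq_def (lam ⊗ₘ κ), if_neg h]; exact le_top
  have hne := ne_top_of_le_ne_top (InformationTheory.klDiv_ne_top h.1 h.2) key
  obtain ⟨hac, hint⟩ := InformationTheory.klDiv_ne_top_iff.1 hne
  rw [InformationTheory.klDiv_of_ac_of_integrable hac hint,
    InformationTheory.klDiv_of_ac_of_integrable h.1 h.2, mass1, mass2, add_sub_cancel_right,
    add_sub_cancel_right] at key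
  have hll : llr (avgMeas T κ n) (lam.prod π) =ᵐ[avgMeas T κ n]
      llr (avgMeas T κ n) ((lam.prod π).restrict S) := by
    filter_upwards [hac.ae_le (rnDeriv_restrict_right' _ _ hS hac)] with x hx
    simp only [llr, hx]
  have hac' : avgMeas T κ n ≪ lam.prod π := hac.trans Measure.absolutelyContinuous_restrict
  rw [relEnt, relEnt, if_pos h, if_pos ⟨hac', (integrable_congr hll).2 hint⟩,
    integral_congr_ae hll]
  exact key
end
end

section
/- Let n ≥ 1 and K ≥ 1 be natural numbers, let π, π_1, …, π_K be Borel probability measures on ℝ^d, and let π̃ be the finite measure on [0, K/n]×ℝ^d given by π̃ := Σ_{k=1}^{K} (λ restricted to [(k−1)/n, k/n]) ⊗ π_k, where λ is Lebesgue measure on ℝ. Then H(π̃ | λ_{[0,K/n]} ⊗ π) = (1/n)·Σ_{k=1}^{K} H(π_k | π), where λ_{[0,K/n]} ⊗ π is the product of Lebesgue measure on [0,K/n] with π. -/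
open MeasureTheory ProbabilityTheory Set Filter
open scoped ENNReal NNReal Topology

noncomputable section

lemma relEnt_eq_klDiv {α : Type*} [MeasurableSpace α] (μ ν : Measure α)
    (h : μ univ = ν univ) : relEnt μ ν = InformationTheory.klDiv μ ν := by
  classical
  unfold relEnt
  rw [InformationTheory.klDiv_def]
  have : μ.real univ = ν.real univ := by simp [measureReal_def, h]
  simp [this]

lemma finsetSum_prod_aux {α β ι : Type*} [MeasurableSpace α] [MeasurableSpace β]
    (s : Finset ι) (ρ : ι → Measure α) [∀ i, IsFiniteMeasure (ρ i)]
    (ν : Measure β) [IsFiniteMeasure ν] :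
    (∑ i ∈ s, ρ i).prod ν = ∑ i ∈ s, (ρ i).prod ν := by
  classical
  induction s using Finset.induction_on with
  | empty => simp
  | insert a s ha ih => rw [Finset.sum_insert ha, Finset.sum_insert ha, Measure.add_prod, ih]

lemma finsetSum_withDensity_aux {α ι : Type*} [MeasurableSpace α]
    (s : Finset ι) (ρ : ι → Measure α) (f : α → ℝ≥0∞) :
    (∑ i ∈ s, ρ i).withDensity f = ∑ i ∈ s, (ρ i).withDensity f := by
  classical
  induction s using Finset.induction_on with
  | empty => simp
  | insert a s ha ih =>
    rw [Finset.sum_insert ha, Finset.sum_insert ha, withDensity_add_measure, ih]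

lemma klDiv_piecewise {α β : Type*} [MeasurableSpace α] [MeasurableSpace β]
    (s : Finset ℕ) (ρ : ℕ → Measure α) [∀ i, IsFiniteMeasure (ρ i)]
    (hρ : ∀ i ∈ s, ρ i univ ≠ 0)
    (g : α → ℕ) (hg : Measurable g) (hgρ : ∀ i ∈ s, ∀ᵐ t ∂(ρ i), g t = i)
    (π : Measure β) [IsProbabilityMeasure π]
    (πk : ℕ → Measure β) [∀ k, IsProbabilityMeasure (πk k)] :
    InformationTheory.klDiv (∑ k ∈ s, (ρ k).prod (πk k)) ((∑ k ∈ s, ρ k).prod π) =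
      ∑ k ∈ s, ρ k univ * InformationTheory.klDiv (πk k) π := by
  by_cases hac : ∀ k ∈ s, πk k ≪ π
  · set f : α × β → ℝ≥0∞ := fun z => (πk (g z.1)).rnDeriv π z.2 with hf
    have hfm : Measurable f := by
      have : Measurable (fun p : ℕ × β => (πk p.1).rnDeriv π p.2) :=
        measurable_from_prod_countable_right fun k => Measure.measurable_rnDeriv (πk k) π
      exact this.comp ((hg.comp measurable_fst).prodMk measurable_snd)
    have hae : ∀ k ∈ s, ∀ᵐ z ∂((ρ k).prod π), f z = (πk k).rnDeriv π z.2 := by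
      intro k hk
      have := Measure.quasiMeasurePreserving_fst (μ := ρ k) (ν := π) |>.ae (hgρ k hk)
      filter_upwards [this] with z hz
      simp only [hf, hz]
    have hμ : (∑ k ∈ s, (ρ k).prod (πk k)) = ((∑ k ∈ s, ρ k).prod π).withDensity f := by
      rw [finsetSum_prod_aux, finsetSum_withDensity_aux]
      refine Finset.sum_congr rfl fun k hk => ?_
      rw [withDensity_congr_ae (hae k hk),
        ← prod_withDensity_right (Measure.measurable_rnDeriv _ _),
        Measure.withDensity_rnDeriv_eq _ _ (hac k hk)]
    have hμν : (∑ k ∈ s, (ρ k).prod (πk k)) ≪ ((∑ k ∈ s, ρ k).prod π) := by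
      rw [hμ]; exact withDensity_absolutelyContinuous _ _
    rw [InformationTheory.klDiv_eq_lintegral_klFun_of_ac hμν]
    have hrn : (∑ k ∈ s, (ρ k).prod (πk k)).rnDeriv ((∑ k ∈ s, ρ k).prod π)
        =ᵐ[(∑ k ∈ s, ρ k).prod π] f := by
      rw [hμ]; exact Measure.rnDeriv_withDensity _ hfm
    have : ∀ᵐ z ∂((∑ k ∈ s, ρ k).prod π),
        ENNReal.ofReal (InformationTheory.klFun ((∑ k ∈ s, (ρ k).prod (πk k)).rnDeriv
          ((∑ k ∈ s, ρ k).prod π) z).toReal) =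
        ENNReal.ofReal (InformationTheory.klFun (f z).toReal) := by
      filter_upwards [hrn] with z hz
      rw [hz]
    rw [lintegral_congr_ae this, finsetSum_prod_aux, lintegral_finsetSum_measure]
    refine Finset.sum_congr rfl fun k hk => ?_
    have h2 : ∀ᵐ z ∂((ρ k).prod π), ENNReal.ofReal (InformationTheory.klFun (f z).toReal) =
        ENNReal.ofReal (InformationTheory.klFun ((πk k).rnDeriv π z.2).toReal) := by
      filter_upwards [hae k hk] with z hz
      rw [hz]
    have hm : Measurable fun x : β =>
        ENNReal.ofReal (InformationTheory.klFun ((πk k).rnDeriv π x).toReal) :=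
      (InformationTheory.measurable_klFun.comp
        (Measure.measurable_rnDeriv _ _).ennreal_toReal).ennreal_ofReal
    rw [lintegral_congr_ae h2, InformationTheory.klDiv_eq_lintegral_klFun_of_ac (hac k hk)]
    refine (lintegral_prod _ (hm.comp measurable_snd).aemeasurable).trans ?_
    simp [mul_comm]
  · push Not at hac
    obtain ⟨k, hk, hkac⟩ := hac
    have hr : ∑ k ∈ s, ρ k univ * InformationTheory.klDiv (πk k) π = ⊤ := by
      refine ENNReal.sum_eq_top.2 ⟨k, hk, ?_⟩
      rw [InformationTheory.klDiv_of_not_ac hkac]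
      exact ENNReal.mul_top (hρ k hk)
    rw [hr]
    refine InformationTheory.klDiv_of_not_ac fun h => hkac ?_
    refine Measure.AbsolutelyContinuous.mk fun t _ h0 => ?_
    have h1 : ((∑ k ∈ s, ρ k).prod π) (univ ×ˢ t) = 0 := by
      rw [Measure.prod_prod, h0, mul_zero]
    have h2 := h h1
    rw [Measure.finsetSum_apply, Finset.sum_eq_zero_iff] at h2
    have h3 := h2 k hk
    rw [Measure.prod_prod, mul_eq_zero] at h3
    exact h3.resolve_left (hρ k hk)

lemma restrict_Ioc_sum (n : ℕ) (hn : 1 ≤ n) (K : ℕ) :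
    (volume : Measure ℝ).restrict (Ioc 0 ((K : ℝ) / n)) =
      ∑ k ∈ Finset.Icc 1 K, volume.restrict (Ioc (((k : ℝ) - 1) / n) ((k : ℝ) / n)) := by
  have hn' : (0 : ℝ) < n := by exact_mod_cast hn
  induction K with
  | zero => simp
  | succ K ih =>
    rw [Finset.sum_Icc_succ_top (by omega), ← ih]
    have e : (((K + 1 : ℕ) : ℝ) - 1) / n = (K : ℝ) / n := by push_cast; ring
    rw [e, ← Measure.restrict_union (Ioc_disjoint_Ioc_of_le le_rfl) measurableSet_Ioc,
      Ioc_union_Ioc_eq_Ioc (by positivity) (by gcongr; simp)]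

/-- chain-rule identity for the relative entropy of a piecewise-constant-in-time
data trajectory measure with respect to `λ_{[0,K/n]} ⊗ π`. -/
theorem relEnt_piecewise_product (d : ℕ) (n K : ℕ) (hn : 1 ≤ n) (hK : 1 ≤ K)
    (π : Measure (EuclideanSpace ℝ (Fin d))) [IsProbabilityMeasure π]
    (πk : ℕ → Measure (EuclideanSpace ℝ (Fin d)))
    (hπk : ∀ k, IsProbabilityMeasure (πk k)) :
    relEnt
      (∑ k ∈ Finset.Icc 1 K,
        (volume.restrict (Set.Icc (((k : ℝ) - 1) / n) ((k : ℝ) / n))).prod (πk k))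
      ((volume.restrict (Set.Icc 0 ((K : ℝ) / n))).prod π) =
      (n : ℝ≥0∞)⁻¹ * ∑ k ∈ Finset.Icc 1 K, relEnt (πk k) π := by
  have hn' : (0 : ℝ) < n := by exact_mod_cast hn
  simp only [← Measure.restrict_congr_set (Ioc_ae_eq_Icc (μ := (volume : Measure ℝ)))]
  set ρ : ℕ → Measure ℝ := fun k =>
    volume.restrict (Ioc (((k : ℝ) - 1) / n) ((k : ℝ) / n)) with hρ
  have hρu : ∀ k, ρ k univ = (n : ℝ≥0∞)⁻¹ := by
    intro k
    have e : (k : ℝ) / n - ((k : ℝ) - 1) / n = (n : ℝ)⁻¹ := by field_simp; ring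
    simp only [hρ, Measure.restrict_apply_univ, Real.volume_Ioc, e]
    rw [ENNReal.ofReal_inv_of_pos hn', ENNReal.ofReal_natCast]
  haveI : ∀ k, IsFiniteMeasure (ρ k) := fun k => by simp only [hρ]; infer_instance
  rw [restrict_Ioc_sum n hn K]
  change relEnt (∑ k ∈ Finset.Icc 1 K, (ρ k).prod (πk k))
    ((∑ k ∈ Finset.Icc 1 K, ρ k).prod π) = _
  rw [relEnt_eq_klDiv, klDiv_piecewise (Finset.Icc 1 K) ρ ?_ (fun t => ⌈(n : ℝ) * t⌉₊) ?_ ?_]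
  · rw [Finset.mul_sum]
    refine Finset.sum_congr rfl fun k _ => ?_
    rw [hρu, relEnt_eq_klDiv]
    simp
  · intro k _
    rw [hρu]
    simp
  · exact Nat.measurable_ceil.comp (measurable_const.mul measurable_id)
  · intro k hk
    have hk1 := (Finset.mem_Icc.1 hk).1
    refine (ae_restrict_iff' measurableSet_Ioc).2 (Eventually.of_forall fun t ht => ?_)
    rw [Nat.ceil_eq_iff (by omega)]
    have h1 := (div_lt_iff₀ hn').1 ht.1
    have h2 := (le_div_iff₀ hn').1 ht.2
    push_cast [Nat.cast_sub hk1]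
    constructor <;> linarith
  · rw [finsetSum_prod_aux]
    simp [Measure.finsetSum_apply, Measure.prod_apply]
end
end

section
/- Assume σ : ℝ → ℝ is differentiable with |σ| ≤ C_σ, |σ'| ≤ C_σ (C_σ ≥ 1) and σ, σ' are Lipschitz with constant L_σ > 1, and let C_traj ≥ 1, C_π ≥ 1, 0 < T_0 ≤ T. Let (κ_s)_{s∈[0,T_0]} be a Markov kernel from [0,T_0] to ℝ^{d'}×ℝ with κ_s supported in the closed ball of radius C_π centered at 0 for every s. Let η¹, η² be Borel probability measures on C([0,T_0], ℝ×ℝ^{d'}), both supported on paths ω with sup_{s≤T_0}‖ω_s‖ ≤ C_traj, and let μ be any coupling of η¹ and η² (a probability measure on the product of two copies of C([0,T_0], ℝ×ℝ^{d'}) with marginals η¹ and η²). Let θ¹, θ² be continuous paths [0,T_0] → ℝ×ℝ^{d'} with sup_{s}‖θ^i_s‖ ≤ C_traj which satisfy θ^i_t = θ^i_0 + ∫_0^t ∫ A(x, θ^i_s; η^i_s) κ_s(dx) ds for all t ∈ [0,T_0] and i = 1,2. Then, with C := 2·C_σ²·C_traj·L_σ·C_π² + 2·C_traj²·C_π³·C_σ²·L_σ,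 one has sup_{s≤T_0} ‖θ¹_s − θ²_s‖ ≤ (T_0·C·(∫ sup_{u≤T_0}‖ω_u − ω'_u‖² dμ(ω,ω'))^{1/2} + ‖θ¹_0 − θ²_0‖)·e^{C·T_0}. -/
open MeasureTheory ProbabilityTheory Set Filter
open scoped ENNReal NNReal InnerProductSpace Topology

noncomputable section

attribute [local instance] MeasureTheory.Measure.Subtype.measureSpace

/-- The space `C([0,T], ℝ × ℝ^{d'})` of continuous paths with the uniform topology. -/
abbrev PathSpace (d' : ℕ) (T : ℝ) := C(Set.Icc (0 : ℝ) T, Param d')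

instance (d' : ℕ) (T : ℝ) : MeasurableSpace (PathSpace d' T) := borel _
instance (d' : ℕ) (T : ℝ) : BorelSpace (PathSpace d' T) := ⟨rfl⟩


lemma pnorm_eq {d' : ℕ} (θ : Param d') : pnorm θ = ‖WithLp.toLp 2 θ‖ := by
  rw [WithLp.prod_norm_eq_of_L2]; simp [pnorm]

lemma pnorm_nonneg {d' : ℕ} (θ : Param d') : 0 ≤ pnorm θ := Real.sqrt_nonneg _

lemma pnorm_add_le {d' : ℕ} (θ θ' : Param d') : pnorm (θ + θ') ≤ pnorm θ + pnorm θ' := by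
  simp only [pnorm_eq, WithLp.toLp_add]; exact norm_add_le _ _

lemma abs_fst_le_pnorm {d' : ℕ} (θ : Param d') : |θ.1| ≤ pnorm θ := by
  apply Real.abs_le_sqrt; nlinarith [sq_nonneg ‖θ.2‖]

lemma norm_snd_le_pnorm {d' : ℕ} (θ : Param d') : ‖θ.2‖ ≤ pnorm θ := by
  apply Real.le_sqrt_of_sq_le; nlinarith [sq_nonneg θ.1]

lemma pnorm_sq {d' : ℕ} (θ : Param d') : pnorm θ ^ 2 = θ.1 ^ 2 + ‖θ.2‖ ^ 2 :=
  Real.sq_sqrt (by positivity)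

lemma continuous_pnorm {d' : ℕ} : Continuous (pnorm : Param d' → ℝ) := by
  unfold pnorm; fun_prop

lemma norm_le_pnorm {d' : ℕ} (θ : Param d') : ‖θ‖ ≤ pnorm θ := by
  rw [Prod.norm_def]; exact max_le (abs_fst_le_pnorm θ) (norm_snd_le_pnorm θ)

lemma pnorm_le_add {d' : ℕ} (θ : Param d') : pnorm θ ≤ |θ.1| + ‖θ.2‖ := by
  unfold pnorm
  rw [Real.sqrt_le_left (by positivity)]
  nlinarith [abs_nonneg θ.1, norm_nonneg θ.2, sq_abs θ.1, mul_nonneg (abs_nonneg θ.1) (norm_nonneg θ.2)]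

lemma pnorm_integral_le {d' : ℕ} {α : Type*} [MeasurableSpace α] (ν : Measure α)
    (f : α → Param d') : pnorm (∫ a, f a ∂ν) ≤ ∫ a, pnorm (f a) ∂ν := by
  have h := ContinuousLinearEquiv.integral_comp_comm (μ := ν)
    (WithLp.prodContinuousLinearEquiv 2 ℝ ℝ (EuclideanSpace ℝ (Fin d'))).symm f
  have h2 : WithLp.toLp 2 (∫ a, f a ∂ν) = ∫ a, WithLp.toLp 2 (f a) ∂ν := h.symm
  simp only [pnorm_eq]
  rw [h2]
  exact norm_integral_le_integral_norm _

lemma abs_lip {σ : ℝ → ℝ} {L : ℝ} (hL : 0 ≤ L) (h : LipschitzWith (Real.toNNReal L) σ) (a b : ℝ) :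
    |σ a - σ b| ≤ L * |a - b| := by
  have := h.dist_le_mul a b
  rwa [Real.dist_eq, Real.dist_eq, Real.coe_toNNReal _ hL] at this

lemma abs_lip' {σ : ℝ → ℝ} {L : ℝ} (hd : Differentiable ℝ σ) (h : ∀ u, |deriv σ u| ≤ L) (a b : ℝ) :
    |σ a - σ b| ≤ L * |a - b| := by
  exact Convex.norm_image_sub_le_of_norm_deriv_le (f := σ) (s := Set.univ)
    (fun x _ => hd x) (fun x _ => h x) convex_univ (Set.mem_univ b) (Set.mem_univ a)

lemma abs_inner_sub {d' : ℕ} (z w w' : EuclideanSpace ℝ (Fin d')) :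
    |⟪z, w⟫_ℝ - ⟪z, w'⟫_ℝ| ≤ ‖z‖ * ‖w - w'‖ := by
  rw [← inner_sub_right]; exact abs_real_inner_le_norm _ _

/-- Lipschitz bound of a single neuron. -/
lemma neuron_lip {d' : ℕ} {σ : ℝ → ℝ} {Cσ Ctraj Cπ : ℝ} (hd : Differentiable ℝ σ)
    (hb : ∀ u, |σ u| ≤ Cσ) (hb' : ∀ u, |deriv σ u| ≤ Cσ) (hC : 0 ≤ Cσ)
    (z : EuclideanSpace ℝ (Fin d')) (hz : ‖z‖ ≤ Cπ) (p q : Param d') (hp : pnorm p ≤ Ctraj) :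
    |p.1 * σ ⟪z, p.2⟫_ℝ - q.1 * σ ⟪z, q.2⟫_ℝ| ≤ Cσ * (1 + Ctraj * Cπ) * pnorm (p - q) := by
  have e : p.1 * σ ⟪z, p.2⟫_ℝ - q.1 * σ ⟪z, q.2⟫_ℝ =
    p.1 * (σ ⟪z, p.2⟫_ℝ - σ ⟪z, q.2⟫_ℝ) + (p.1 - q.1) * σ ⟪z, q.2⟫_ℝ := by ring
  have h1 : |p.1| ≤ Ctraj := (abs_fst_le_pnorm p).trans hp
  have h0 := (abs_nonneg _).trans h1
  have hπ := (norm_nonneg _).trans hz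
  have h2 : |p.1 - q.1| ≤ pnorm (p - q) := abs_fst_le_pnorm (p - q)
  have h3 : ‖p.2 - q.2‖ ≤ pnorm (p - q) := norm_snd_le_pnorm (p - q)
  have h4 : |σ ⟪z, p.2⟫_ℝ - σ ⟪z, q.2⟫_ℝ| ≤ Cσ * (Cπ * pnorm (p - q)) := by
    refine (abs_lip' hd hb' _ _).trans ?_
    gcongr
    exact (abs_inner_sub _ _ _).trans (by gcongr)
  rw [e]
  refine (abs_add_le _ _).trans ?_
  rw [abs_mul, abs_mul]
  calc _ ≤ Ctraj * (Cσ * (Cπ * pnorm (p - q))) + pnorm (p - q) * Cσ := by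
        gcongr
        · exact pnorm_nonneg _
        · exact hb _
    _ = _ := by ring

lemma scalar_aux {P Q dc dw N : ℝ} (hP0 : 0 ≤ P) (hQ0 : 0 ≤ Q) (hdc0 : 0 ≤ dc) (hdw0 : 0 ≤ dw)
    (hsq : N ^ 2 = dc ^ 2 + dw ^ 2) :
    (P * dw) ^ 2 + (P * dc + Q * dw) ^ 2 ≤ ((P + Q) * N) ^ 2 := by
  have e : ((P + Q) * N) ^ 2 = (P + Q) ^ 2 * (dc ^ 2 + dw ^ 2) := by rw [← hsq]; ring
  rw [e]
  have h1 : 0 ≤ P * Q * (dc - dw) ^ 2 := by positivity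
  have h2 : 0 ≤ P * Q * (dc ^ 2 + dw ^ 2) := by positivity
  have h3 : 0 ≤ Q * Q * dc ^ 2 := by positivity
  linarith

lemma gradA_diff {d' : ℕ} {σ : ℝ → ℝ} {Cσ Lσ Ctraj Cπ D : ℝ} (hd : Differentiable ℝ σ)
    (hb : ∀ u, |σ u| ≤ Cσ) (hb' : ∀ u, |deriv σ u| ≤ Cσ) (hC : 1 ≤ Cσ) (hL : 1 < Lσ)
    (hLip : LipschitzWith (Real.toNNReal Lσ) (deriv σ)) (hT : 1 ≤ Ctraj) (hP : 1 ≤ Cπ)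
    (x : Data d') (hx : dnorm x ≤ Cπ) (p q : Param d') (hp : pnorm p ≤ Ctraj)
    (hq : pnorm q ≤ Ctraj) (ν₁ ν₂ : Measure (Param d'))
    (hF : |netF σ x.1 ν₁| ≤ Ctraj * Cσ) (hD : 0 ≤ D)
    (hg : |netF σ x.1 ν₁ - netF σ x.1 ν₂| ≤ Cσ * (1 + Ctraj * Cπ) * D) :
    pnorm (gradA σ x p ν₁ - gradA σ x q ν₂) ≤
      (2 * Cσ ^ 2 * Ctraj * Lσ * Cπ ^ 2 + 2 * Ctraj ^ 2 * Cπ ^ 3 * Cσ ^ 2 * Lσ) * pnorm (p - q)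
      + (2 * Cσ ^ 2 * Ctraj * Lσ * Cπ ^ 2 + 2 * Ctraj ^ 2 * Cπ ^ 3 * Cσ ^ 2 * Lσ) * D := by
  have hz : ‖x.1‖ ≤ Cπ := le_trans (Real.le_sqrt_of_sq_le (by nlinarith [sq_nonneg x.2])) hx
  have hy : |x.2| ≤ Cπ := le_trans (Real.abs_le_sqrt (by nlinarith [sq_nonneg ‖x.1‖])) hx
  obtain ⟨z, y⟩ := x
  simp only at hz hy hF hg
  set g₁ := lossG σ (z, y) ν₁ with hg₁
  set g₂ := lossG σ (z, y) ν₂ with hg₂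
  have hgd : |g₁ - g₂| ≤ Cσ * (1 + Ctraj * Cπ) * D := by
    have : g₁ - g₂ = -(netF σ z ν₁ - netF σ z ν₂) := by simp [hg₁, hg₂, lossG]
    rw [this, abs_neg]; exact hg
  have hg1 : |g₁| ≤ 2 * Cπ * Ctraj * Cσ := by
    have : |g₁| ≤ |y| + |netF σ z ν₁| := by simpa [hg₁, lossG] using abs_sub y (netF σ z ν₁)
    have h1 : Cπ ≤ Cπ * (Ctraj * Cσ) := le_mul_of_one_le_right (by linarith) (by nlinarith)
    have h2 : Ctraj * Cσ ≤ Cπ * (Ctraj * Cσ) := le_mul_of_one_le_left (by positivity) hP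
    nlinarith
  set Bp : Param d' := (σ ⟪z, p.2⟫_ℝ, (p.1 * deriv σ ⟪z, p.2⟫_ℝ) • z) with hBp
  set Bq : Param d' := (σ ⟪z, q.2⟫_ℝ, (q.1 * deriv σ ⟪z, q.2⟫_ℝ) • z) with hBq
  have e : gradA σ (z, y) p ν₁ - gradA σ (z, y) q ν₂ = g₁ • (Bp - Bq) + (g₁ - g₂) • Bq := by
    ext1
    · simp [gradA, hBp, hBq, ← hg₁, ← hg₂]; ring
    · simp [gradA, hBp, hBq, ← hg₁, ← hg₂]; module
  have hs (a : ℝ) (v : Param d') : pnorm (a • v) = |a| * pnorm v := by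
    simp [pnorm_eq, WithLp.toLp_smul, norm_smul]
  have hBqn : pnorm Bq ≤ Cσ * (1 + Ctraj * Cπ) := by
    refine (pnorm_le_add _).trans ?_
    simp only [hBq, norm_smul, Real.norm_eq_abs, abs_mul]
    have : |q.1| ≤ Ctraj := (abs_fst_le_pnorm q).trans hq
    calc _ ≤ Cσ + Ctraj * Cσ * Cπ := by
          gcongr
          · exact hb _
          · exact hb' _
      _ = _ := by ring
  have hBd : pnorm (Bp - Bq) ≤ (Cσ * Cπ + Ctraj * Lσ * Cπ ^ 2) * pnorm (p - q) := by
    set dc := |p.1 - q.1| with hdc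
    set dw := ‖p.2 - q.2‖ with hdw
    have hdc0 : 0 ≤ dc := abs_nonneg _
    have hdw0 : 0 ≤ dw := norm_nonneg _
    have h1 : |σ ⟪z, p.2⟫_ℝ - σ ⟪z, q.2⟫_ℝ| ≤ Cσ * Cπ * dw := by
      refine (abs_lip' hd hb' _ _).trans ?_
      rw [mul_assoc]
      gcongr
      exact (abs_inner_sub _ _ _).trans (by gcongr)
    have h2 : |deriv σ ⟪z, p.2⟫_ℝ - deriv σ ⟪z, q.2⟫_ℝ| ≤ Lσ * (Cπ * dw) := by
      refine (abs_lip (by linarith) hLip _ _).trans ?_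
      gcongr
      exact (abs_inner_sub _ _ _).trans (by gcongr)
    have h3 : ‖(p.1 * deriv σ ⟪z, p.2⟫_ℝ) • z - (q.1 * deriv σ ⟪z, q.2⟫_ℝ) • z‖
        ≤ Cσ * Cπ * dc + Ctraj * Lσ * Cπ ^ 2 * dw := by
      rw [← sub_smul, norm_smul, Real.norm_eq_abs]
      have e2 : p.1 * deriv σ ⟪z, p.2⟫_ℝ - q.1 * deriv σ ⟪z, q.2⟫_ℝ =
        (p.1 - q.1) * deriv σ ⟪z, p.2⟫_ℝ +
          q.1 * (deriv σ ⟪z, p.2⟫_ℝ - deriv σ ⟪z, q.2⟫_ℝ) := by ring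
      have hq1 : |q.1| ≤ Ctraj := (abs_fst_le_pnorm q).trans hq
      have h4 : |p.1 * deriv σ ⟪z, p.2⟫_ℝ - q.1 * deriv σ ⟪z, q.2⟫_ℝ| ≤
          dc * Cσ + Ctraj * (Lσ * (Cπ * dw)) := by
        rw [e2]
        refine (abs_add_le _ _).trans ?_
        rw [abs_mul, abs_mul]
        gcongr
        exact hb' _
      calc _ ≤ (dc * Cσ + Ctraj * (Lσ * (Cπ * dw))) * Cπ := by gcongr
        _ = _ := by ring
    have hsq : pnorm (p - q) ^ 2 = dc ^ 2 + dw ^ 2 := by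
      rw [pnorm_sq, hdc, sq_abs]; rfl
    have hn := pnorm_nonneg (p - q)
    have hdwle : dw ≤ pnorm (p - q) := norm_snd_le_pnorm (p - q)
    have hP0 : 0 ≤ Cσ * Cπ := by positivity
    have hQ0 : 0 ≤ Ctraj * Lσ * Cπ ^ 2 := by positivity
    generalize Cσ * Cπ = P at *
    generalize Ctraj * Lσ * Cπ ^ 2 = Q at *
    apply Real.sqrt_le_iff.mpr
    refine ⟨by positivity, ?_⟩
    have h5 : (Bp - Bq).1 ^ 2 ≤ (P * dw) ^ 2 := sq_le_sq' (abs_le.mp h1).1 (abs_le.mp h1).2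
    have h6 : ‖(Bp - Bq).2‖ ^ 2 ≤ (P * dc + Q * dw) ^ 2 := by
      apply pow_le_pow_left₀ (norm_nonneg _) h3
    exact (add_le_add h5 h6).trans (scalar_aux hP0 hQ0 hdc0 hdw0 hsq)
  rw [e]
  refine (pnorm_add_le _ _).trans ?_
  rw [hs, hs]
  have hn := pnorm_nonneg (p - q)
  apply add_le_add
  · calc _ ≤ (2 * Cπ * Ctraj * Cσ) * ((Cσ * Cπ + Ctraj * Lσ * Cπ ^ 2) * pnorm (p - q)) := by
          gcongr
          exact pnorm_nonneg _
      _ = (2 * Cσ ^ 2 * Ctraj * 1 * Cπ ^ 2 + 2 * Ctraj ^ 2 * Cπ ^ 3 * (Cσ * 1) * Lσ)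
          * pnorm (p - q) := by ring
      _ ≤ _ := by
          gcongr
          nlinarith
  · calc _ ≤ (Cσ * (1 + Ctraj * Cπ) * D) * (Cσ * (1 + Ctraj * Cπ)) := by
          gcongr
          exact pnorm_nonneg _
      _ = (Cσ ^ 2 * (2 * Ctraj * Cπ * 1) + Cσ ^ 2 * (1 + Ctraj ^ 2 * Cπ ^ 2)) * D := by ring
      _ ≤ (Cσ ^ 2 * (2 * Ctraj * Cπ * (Lσ * Cπ)) + Cσ ^ 2 * (2 * Ctraj ^ 2 * Cπ ^ 3 * Lσ)) * D := by
          have k1 : 1 ≤ Ctraj ^ 2 * Cπ ^ 2 := by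
            have : 1 ≤ Ctraj ^ 2 := one_le_pow₀ hT
            have : 1 ≤ Cπ ^ 2 := one_le_pow₀ hP
            nlinarith
          have k2 : 1 ≤ Lσ * Cπ := by nlinarith
          have k3 := mul_le_mul_of_nonneg_left k2 (by positivity : 0 ≤ Ctraj ^ 2 * Cπ ^ 2)
          gcongr
          nlinarith
      _ = _ := by ring

lemma gronwall_Icc {T₀ C a : ℝ} (hT₀ : 0 < T₀) (hC : 0 ≤ C)
    (u : C(Set.Icc (0 : ℝ) T₀, ℝ))
    (h : ∀ t : Set.Icc (0 : ℝ) T₀,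
      u t ≤ a + ∫ s in {v : Set.Icc (0 : ℝ) T₀ | (v : ℝ) ≤ (t : ℝ)}, C * u s)
    (ha : 0 ≤ a) :
    ∀ t, u t ≤ a * Real.exp (C * T₀) := by
  set U : ℝ → ℝ := Set.IccExtend hT₀.le u with hU
  have hUc : Continuous U := u.continuous.Icc_extend'
  have conv : ∀ t : Set.Icc (0 : ℝ) T₀,
      ∫ s in {v : Set.Icc (0 : ℝ) T₀ | (v : ℝ) ≤ (t : ℝ)}, C * u s
        = ∫ s in (0 : ℝ)..t, C * U s := by
    intro t
    rw [intervalIntegral.integral_of_le t.2.1, ← integral_Icc_eq_integral_Ioc]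
    have e1 : ∀ s : Set.Icc (0 : ℝ) T₀, C * u s = C * U s := by
      intro s; rw [hU, Set.IccExtend_val]
    simp_rw [e1]
    have hme : MeasurableEmbedding (Subtype.val : Set.Icc (0 : ℝ) T₀ → ℝ) :=
      MeasurableEmbedding.subtype_coe measurableSet_Icc
    have hvol : (volume : Measure (Set.Icc (0 : ℝ) T₀)) = Measure.comap Subtype.val volume := rfl
    have hmap : Measure.map (Subtype.val : Set.Icc (0 : ℝ) T₀ → ℝ)
        (volume : Measure (Set.Icc (0 : ℝ) T₀)) = volume.restrict (Set.Icc 0 T₀) := by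
      rw [hvol, hme.map_comap, Subtype.range_coe]
    have := hme.setIntegral_map (μ := (volume : Measure (Set.Icc (0 : ℝ) T₀)))
      (fun s => C * U s) (Set.Iic (t : ℝ))
    rw [hmap, Measure.restrict_restrict measurableSet_Iic] at this
    have e2 : Set.Iic (t : ℝ) ∩ Set.Icc 0 T₀ = Set.Icc 0 (t : ℝ) := by
      ext s; simp only [Set.mem_inter_iff, Set.mem_Iic, Set.mem_Icc]
      have := t.2.2
      constructor
      · rintro ⟨h1, h2, h3⟩; exact ⟨h2, h1⟩
      · rintro ⟨h1, h2⟩; exact ⟨h2, h1, h2.trans this⟩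
    rw [e2] at this
    exact this.symm
  set f : ℝ → ℝ := fun t => a + ∫ s in (0 : ℝ)..t, C * U s with hf
  have hder : ∀ t, HasDerivAt f (C * U t) t := by
    intro t
    have hc : Continuous fun s => C * U s := by fun_prop
    exact (intervalIntegral.integral_hasDerivAt_right (hc.intervalIntegrable _ _)
      (hc.stronglyMeasurableAtFilter _ _) hc.continuousAt).const_add a
  have hUle : ∀ t ∈ Set.Icc 0 T₀, U t ≤ f t := by
    intro t ht
    have := h ⟨t, ht⟩
    rw [conv] at this
    rwa [hU, Set.IccExtend_of_mem _ _ ht]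
  have key := le_gronwallBound_of_liminf_deriv_right_le (f := f) (f' := fun t => C * U t)
    (δ := a) (K := C) (ε := 0) (a := 0) (b := T₀)
    (fun x _ => (hder x).continuousAt.continuousWithinAt)
    (fun x _ r hr => (hder x).hasDerivWithinAt.liminf_right_slope_le hr)
    (by simp [hf])
    (fun x hx => by
      have := mul_le_mul_of_nonneg_left (hUle x ⟨hx.1, hx.2.le⟩) hC
      simpa using this)
  intro t
  have h1 := hUle t t.2
  rw [hU, Set.IccExtend_val] at h1
  have h2 := key t t.2
  rw [gronwallBound_ε0, sub_zero] at h2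
  refine h1.trans (h2.trans ?_)
  have := t.2.2
  gcongr

lemma sq_integral_le {α : Type*} [MeasurableSpace α] (ν : Measure α) [IsProbabilityMeasure ν]
    (X : α → ℝ) (h1 : Integrable X ν) (h2 : Integrable (fun a => X a ^ 2) ν) :
    (∫ a, X a ∂ν) ^ 2 ≤ ∫ a, X a ^ 2 ∂ν := by
  set m := ∫ a, X a ∂ν with hm
  have h : 0 ≤ ∫ a, (X a - m) ^ 2 ∂ν := integral_nonneg fun a => sq_nonneg _
  have e : ∫ a, (X a - m) ^ 2 ∂ν = (∫ a, X a ^ 2 ∂ν) - m ^ 2 := by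
    have : ∀ a, (X a - m) ^ 2 = X a ^ 2 - 2 * m * X a + m ^ 2 := fun a => by ring
    simp_rw [this]
    have h3 : Integrable (fun a => X a ^ 2 - 2 * m * X a) ν := h2.sub (h1.const_mul _)
    rw [integral_add h3 (integrable_const _),
      integral_sub h2 (h1.const_mul _), integral_const_mul, ← hm]
    simp; ring
  linarith

/-- eval-map formula. -/
lemma netF_map {d' : ℕ} {T₀ : ℝ} {σ : ℝ → ℝ} (hσ : Continuous σ) (η : Measure (PathSpace d' T₀))
    (s : Set.Icc (0 : ℝ) T₀) (z : EuclideanSpace ℝ (Fin d')) :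
    netF σ z (η.map (fun ω : PathSpace d' T₀ => ω s)) =
      ∫ ω, (ω s).1 * σ ⟪z, (ω s).2⟫_ℝ ∂η := by
  unfold netF
  rw [integral_map]
  · exact (Continuous.measurable (by fun_prop)).aemeasurable
  · apply Continuous.aestronglyMeasurable; fun_prop

lemma netF_joint {d' : ℕ} {T₀ : ℝ} {σ : ℝ → ℝ} (hσ : Continuous σ) (η : Measure (PathSpace d' T₀))
    [IsProbabilityMeasure η] :
    Measurable (fun q : Set.Icc (0 : ℝ) T₀ × Data d' =>
      netF σ q.2.1 (η.map (fun ω : PathSpace d' T₀ => ω q.1))) := by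
  simp_rw [netF_map hσ]
  have hc : Continuous (fun r : (Set.Icc (0 : ℝ) T₀ × Data d') × PathSpace d' T₀ =>
      (r.2 r.1.1).1 * σ ⟪r.1.2.1, (r.2 r.1.1).2⟫_ℝ) := by fun_prop
  exact (StronglyMeasurable.integral_prod_right' (ν := η) hc.measurable.stronglyMeasurable).measurable

lemma inner_measurable {d' : ℕ} {T₀ : ℝ} {σ : ℝ → ℝ} (hσ : Continuous σ)
    (hσ' : Continuous (deriv σ)) (η : Measure (PathSpace d' T₀)) [IsProbabilityMeasure η]
    (κ : Kernel ℝ (Data d')) [IsMarkovKernel κ] (θ : PathSpace d' T₀) :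
    StronglyMeasurable (fun s : Set.Icc (0 : ℝ) T₀ =>
      ∫ x, gradA σ x (θ s) (η.map (fun ω : PathSpace d' T₀ => ω s)) ∂(κ (s : ℝ))) := by
  have hF := netF_joint hσ η
  have hm : Measurable (fun q : Set.Icc (0 : ℝ) T₀ × Data d' =>
      gradA σ q.2 (θ q.1) (η.map (fun ω : PathSpace d' T₀ => ω q.1))) := by
    unfold gradA lossG
    have m1 : Measurable (fun q : Set.Icc (0 : ℝ) T₀ × Data d' => σ ⟪q.2.1, (θ q.1).2⟫_ℝ) :=
      Continuous.measurable (by fun_prop)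
    have m2 : Measurable (fun q : Set.Icc (0 : ℝ) T₀ × Data d' =>
        deriv σ ⟪q.2.1, (θ q.1).2⟫_ℝ) :=
      Continuous.measurable (by fun_prop)
    have m3 : Measurable (fun q : Set.Icc (0 : ℝ) T₀ × Data d' => (θ q.1).1) :=
      Continuous.measurable (by fun_prop)
    have m4 : Measurable (fun q : Set.Icc (0 : ℝ) T₀ × Data d' => q.2.2) := by fun_prop
    have m5 : Measurable (fun q : Set.Icc (0 : ℝ) T₀ × Data d' => q.2.1) := by fun_prop
    exact ((m4.sub hF).mul m1).prodMk ((((m4.sub hF).mul m3).mul m2).smul m5)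
  exact StronglyMeasurable.integral_kernel_prod_right'
    (κ := κ.comap (Subtype.val : Set.Icc (0 : ℝ) T₀ → ℝ) measurable_subtype_coe)
    hm.stronglyMeasurable

lemma netF_bound {d' : ℕ} {T₀ : ℝ} {σ : ℝ → ℝ} (hσ : Continuous σ) (η : Measure (PathSpace d' T₀))
    [IsProbabilityMeasure η] {Cσ Ctraj : ℝ} (hb : ∀ u, |σ u| ≤ Cσ) (hT : 0 ≤ Ctraj)
    (hη : ∀ᵐ ω ∂η, ∀ s : Set.Icc (0 : ℝ) T₀, pnorm (ω s) ≤ Ctraj)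
    (s : Set.Icc (0 : ℝ) T₀) (z : EuclideanSpace ℝ (Fin d')) :
    |netF σ z (η.map (fun ω : PathSpace d' T₀ => ω s))| ≤ Ctraj * Cσ := by
  rw [netF_map hσ]
  have := norm_integral_le_of_norm_le_const (μ := η) (C := Ctraj * Cσ)
    (f := fun ω : PathSpace d' T₀ => (ω s).1 * σ ⟪z, (ω s).2⟫_ℝ) (by
      filter_upwards [hη] with ω hω
      rw [norm_mul, Real.norm_eq_abs, Real.norm_eq_abs]
      exact mul_le_mul ((abs_fst_le_pnorm _).trans (hω s)) (hb _) (abs_nonneg _) hT)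
  simpa using this

lemma gradA_bound {d' : ℕ} {σ : ℝ → ℝ} {Cσ Ctraj Cπ : ℝ}
    (hb : ∀ u, |σ u| ≤ Cσ) (hb' : ∀ u, |deriv σ u| ≤ Cσ)
    (x : Data d') (hx : dnorm x ≤ Cπ) (p : Param d') (hp : pnorm p ≤ Ctraj)
    (ν : Measure (Param d')) (hF : |netF σ x.1 ν| ≤ Ctraj * Cσ) :
    ‖gradA σ x p ν‖ ≤ (Cπ + Ctraj * Cσ) * Cσ + (Cπ + Ctraj * Cσ) * Ctraj * Cσ * Cπ := by
  have hz : ‖x.1‖ ≤ Cπ := le_trans (Real.le_sqrt_of_sq_le (by nlinarith [sq_nonneg x.2])) hx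
  have hy : |x.2| ≤ Cπ := le_trans (Real.abs_le_sqrt (by nlinarith [sq_nonneg ‖x.1‖])) hx
  have hg : |lossG σ x ν| ≤ Cπ + Ctraj * Cσ := (abs_sub _ _).trans (add_le_add hy hF)
  have hp1 : |p.1| ≤ Ctraj := (abs_fst_le_pnorm p).trans hp
  have g0 := (abs_nonneg _).trans hg
  have c0 := (abs_nonneg _).trans (hb 0)
  have t0 := (abs_nonneg _).trans hp1
  refine (norm_le_pnorm _).trans ((pnorm_le_add _).trans ?_)
  simp only [gradA, norm_smul, Real.norm_eq_abs, abs_mul]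
  gcongr
  · exact hb _
  · exact hb' _

lemma netF_diff {d' : ℕ} {T₀ : ℝ} (hT₀ : 0 < T₀) {σ : ℝ → ℝ} {Cσ Ctraj Cπ : ℝ}
    (hd : Differentiable ℝ σ) (hb : ∀ u, |σ u| ≤ Cσ) (hb' : ∀ u, |deriv σ u| ≤ Cσ) (hC : 0 ≤ Cσ)
    (hT : 0 ≤ Ctraj) (hP : 0 ≤ Cπ)
    (η₁ η₂ : Measure (PathSpace d' T₀))
    (hη₁ : ∀ᵐ ω ∂η₁, ∀ s : Set.Icc (0 : ℝ) T₀, pnorm (ω s) ≤ Ctraj)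
    (hη₂ : ∀ᵐ ω ∂η₂, ∀ s : Set.Icc (0 : ℝ) T₀, pnorm (ω s) ≤ Ctraj)
    (μ : Measure (PathSpace d' T₀ × PathSpace d' T₀)) [IsProbabilityMeasure μ]
    (hμ₁ : μ.map Prod.fst = η₁) (hμ₂ : μ.map Prod.snd = η₂)
    (s : Set.Icc (0 : ℝ) T₀) (z : EuclideanSpace ℝ (Fin d')) (hz : ‖z‖ ≤ Cπ) :
    |netF σ z (η₁.map (fun ω : PathSpace d' T₀ => ω s)) -
      netF σ z (η₂.map (fun ω : PathSpace d' T₀ => ω s))| ≤ Cσ * (1 + Ctraj * Cπ) *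
        Real.sqrt (∫ p, (⨆ u : Set.Icc (0 : ℝ) T₀, pnorm (p.1 u - p.2 u) ^ 2) ∂μ) := by
  have hσ := hd.continuous
  have hc : Continuous (fun ω : PathSpace d' T₀ => (ω s).1 * σ ⟪z, (ω s).2⟫_ℝ) := by fun_prop
  have a1 : ∀ᵐ p ∂μ, ∀ u : Set.Icc (0 : ℝ) T₀, pnorm (p.1 u) ≤ Ctraj := by
    rw [← hμ₁] at hη₁
    exact ae_of_ae_map measurable_fst.aemeasurable hη₁
  have a2 : ∀ᵐ p ∂μ, ∀ u : Set.Icc (0 : ℝ) T₀, pnorm (p.2 u) ≤ Ctraj := by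
    rw [← hμ₂] at hη₂
    exact ae_of_ae_map measurable_snd.aemeasurable hη₂
  have nb : ∀ ω : PathSpace d' T₀, pnorm (ω s) ≤ Ctraj →
      ‖(ω s).1 * σ ⟪z, (ω s).2⟫_ℝ‖ ≤ Ctraj * Cσ := by
    intro ω hω
    rw [norm_mul, Real.norm_eq_abs, Real.norm_eq_abs]
    exact mul_le_mul ((abs_fst_le_pnorm _).trans hω) (hb _) (abs_nonneg _) hT
  have i1 : Integrable (fun p : PathSpace d' T₀ × PathSpace d' T₀ =>
      (p.1 s).1 * σ ⟪z, (p.1 s).2⟫_ℝ) μ :=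
    Integrable.of_bound (hc.comp continuous_fst).measurable.aestronglyMeasurable (Ctraj * Cσ)
      (by filter_upwards [a1] with p hp using nb _ (hp s))
  have i2 : Integrable (fun p : PathSpace d' T₀ × PathSpace d' T₀ =>
      (p.2 s).1 * σ ⟪z, (p.2 s).2⟫_ℝ) μ :=
    Integrable.of_bound (hc.comp continuous_snd).measurable.aestronglyMeasurable (Ctraj * Cσ)
      (by filter_upwards [a2] with p hp using nb _ (hp s))
  have e1 : netF σ z (η₁.map (fun ω : PathSpace d' T₀ => ω s)) =
      ∫ p, (p.1 s).1 * σ ⟪z, (p.1 s).2⟫_ℝ ∂μ := by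
    rw [netF_map hσ, ← hμ₁, integral_map measurable_fst.aemeasurable
      hc.measurable.aestronglyMeasurable]
  have e2 : netF σ z (η₂.map (fun ω : PathSpace d' T₀ => ω s)) =
      ∫ p, (p.2 s).1 * σ ⟪z, (p.2 s).2⟫_ℝ ∂μ := by
    rw [netF_map hσ, ← hμ₂, integral_map measurable_snd.aemeasurable
      hc.measurable.aestronglyMeasurable]
  have pn : ∀ p : PathSpace d' T₀ × PathSpace d' T₀,
      (∀ u : Set.Icc (0 : ℝ) T₀, pnorm (p.1 u) ≤ Ctraj) →
      (∀ u : Set.Icc (0 : ℝ) T₀, pnorm (p.2 u) ≤ Ctraj) →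
      ∀ u, pnorm (p.1 u - p.2 u) ≤ 2 * Ctraj := by
    intro p h1 h2 u
    have : pnorm (p.1 u - p.2 u) ≤ pnorm (p.1 u) + pnorm (p.2 u) := by
      simp only [pnorm_eq, WithLp.toLp_sub]; exact norm_sub_le _ _
    linarith [h1 u, h2 u]
  have hXc : Continuous (fun p : PathSpace d' T₀ × PathSpace d' T₀ => pnorm (p.1 s - p.2 s)) :=
    continuous_pnorm.comp (by fun_prop)
  have iX : Integrable (fun p : PathSpace d' T₀ × PathSpace d' T₀ => pnorm (p.1 s - p.2 s)) μ :=
    Integrable.of_bound hXc.measurable.aestronglyMeasurable (2 * Ctraj) (by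
      filter_upwards [a1, a2] with p h1 h2
      rw [Real.norm_of_nonneg (pnorm_nonneg _)]
      exact pn p h1 h2 s)
  have iX2 : Integrable
      (fun p : PathSpace d' T₀ × PathSpace d' T₀ => pnorm (p.1 s - p.2 s) ^ 2) μ :=
    Integrable.of_bound (hXc.pow 2).measurable.aestronglyMeasurable ((2 * Ctraj) ^ 2) (by
      filter_upwards [a1, a2] with p h1 h2
      rw [Real.norm_of_nonneg (sq_nonneg _)]
      exact pow_le_pow_left₀ (pnorm_nonneg _) (pn p h1 h2 s) 2)
  have hSc : Continuous (fun p : PathSpace d' T₀ × PathSpace d' T₀ =>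
      ⨆ u : Set.Icc (0 : ℝ) T₀, pnorm (p.1 u - p.2 u) ^ 2) := by
    have := IsCompact.continuous_sSup (K := (Set.univ : Set (Set.Icc (0 : ℝ) T₀))) isCompact_univ
      (f := fun (p : PathSpace d' T₀ × PathSpace d' T₀) u => pnorm (p.1 u - p.2 u) ^ 2)
      (by
        have h0 : Continuous (fun q : (PathSpace d' T₀ × PathSpace d' T₀) × Set.Icc (0 : ℝ) T₀ =>
          q.1.1 q.2 - q.1.2 q.2) := by fun_prop
        exact (continuous_pnorm.comp h0).pow 2)
    simpa [Set.image_univ, sSup_range] using this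
  have : Nonempty (Set.Icc (0 : ℝ) T₀) := ⟨s⟩
  have iS : Integrable (fun p : PathSpace d' T₀ × PathSpace d' T₀ =>
      ⨆ u : Set.Icc (0 : ℝ) T₀, pnorm (p.1 u - p.2 u) ^ 2) μ :=
    Integrable.of_bound hSc.measurable.aestronglyMeasurable ((2 * Ctraj) ^ 2) (by
      filter_upwards [a1, a2] with p h1 h2
      rw [Real.norm_of_nonneg (Real.iSup_nonneg fun _ => sq_nonneg _)]
      exact ciSup_le fun u => pow_le_pow_left₀ (pnorm_nonneg _) (pn p h1 h2 u) 2)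
  have hXle : ∫ p, pnorm (p.1 s - p.2 s) ∂μ ≤
      Real.sqrt (∫ p, (⨆ u : Set.Icc (0 : ℝ) T₀, pnorm (p.1 u - p.2 u) ^ 2) ∂μ) := by
    apply Real.le_sqrt_of_sq_le
    refine (sq_integral_le μ _ iX iX2).trans ?_
    apply integral_mono_ae iX2 iS
    filter_upwards [a1, a2] with p h1 h2
    exact le_ciSup (f := fun u : Set.Icc (0 : ℝ) T₀ => pnorm (p.1 u - p.2 u) ^ 2)
      ⟨(2 * Ctraj) ^ 2, by
        rintro _ ⟨u, rfl⟩
        exact pow_le_pow_left₀ (pnorm_nonneg _) (pn p h1 h2 u) 2⟩ s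
  rw [e1, e2, ← integral_sub i1 i2]
  calc _ ≤ ∫ p, Cσ * (1 + Ctraj * Cπ) * pnorm (p.1 s - p.2 s) ∂μ := by
        rw [← Real.norm_eq_abs]
        refine norm_integral_le_of_norm_le (iX.const_mul _) ?_
        filter_upwards [a1] with p h1
        exact neuron_lip hd hb hb' hC z hz (p.1 s) (p.2 s) (h1 s)
    _ = Cσ * (1 + Ctraj * Cπ) * ∫ p, pnorm (p.1 s - p.2 s) ∂μ := integral_const_mul _ _
    _ ≤ _ := by gcongr

/-- Gronwall-type stability estimate for two solutions of the evolution
equation driven by two coupled path measures. -/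
theorem evolution_gronwall_stability {d' : ℕ} (σ : ℝ → ℝ) (Cσ Lσ Ctraj Cπ T T₀ : ℝ)
    (hσdiff : Differentiable ℝ σ) (hσbd : ∀ u, |σ u| ≤ Cσ) (hσ'bd : ∀ u, |deriv σ u| ≤ Cσ)
    (hCσ : 1 ≤ Cσ) (hLσ : 1 < Lσ)
    (hσLip : LipschitzWith (Real.toNNReal Lσ) σ)
    (hσ'Lip : LipschitzWith (Real.toNNReal Lσ) (deriv σ))
    (hCtraj : 1 ≤ Ctraj) (hCπ : 1 ≤ Cπ) (hT₀ : 0 < T₀) (hT : T₀ ≤ T)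
    (κ : Kernel ℝ (Data d')) [IsMarkovKernel κ]
    (hκ : ∀ s : ℝ, s ∈ Set.Icc (0 : ℝ) T₀ → ∀ᵐ x ∂(κ s), dnorm x ≤ Cπ)
    (η₁ η₂ : Measure (PathSpace d' T₀))
    [IsProbabilityMeasure η₁] [IsProbabilityMeasure η₂]
    (hη₁ : ∀ᵐ ω ∂η₁, ∀ s : Set.Icc (0 : ℝ) T₀, pnorm (ω s) ≤ Ctraj)
    (hη₂ : ∀ᵐ ω ∂η₂, ∀ s : Set.Icc (0 : ℝ) T₀, pnorm (ω s) ≤ Ctraj)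
    (μ : Measure (PathSpace d' T₀ × PathSpace d' T₀)) [IsProbabilityMeasure μ]
    (hμ₁ : μ.map Prod.fst = η₁) (hμ₂ : μ.map Prod.snd = η₂)
    (θ₁ θ₂ : PathSpace d' T₀)
    (hθ₁bd : ∀ s : Set.Icc (0 : ℝ) T₀, pnorm (θ₁ s) ≤ Ctraj)
    (hθ₂bd : ∀ s : Set.Icc (0 : ℝ) T₀, pnorm (θ₂ s) ≤ Ctraj)
    (hθ₁int : ∀ s : Set.Icc (0 : ℝ) T₀,
      Integrable (fun x => gradA σ x (θ₁ s) (η₁.map (fun ω : PathSpace d' T₀ => ω s)))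
        (κ (s : ℝ)))
    (hθ₂int : ∀ s : Set.Icc (0 : ℝ) T₀,
      Integrable (fun x => gradA σ x (θ₂ s) (η₂.map (fun ω : PathSpace d' T₀ => ω s)))
        (κ (s : ℝ)))
    (hθ₁ : ∀ t : Set.Icc (0 : ℝ) T₀,
      θ₁ t = θ₁ ⟨0, Set.left_mem_Icc.mpr hT₀.le⟩ +
        ∫ s in {u : Set.Icc (0 : ℝ) T₀ | (u : ℝ) ≤ (t : ℝ)},
          ∫ x, gradA σ x (θ₁ s) (η₁.map (fun ω : PathSpace d' T₀ => ω s)) ∂(κ (s : ℝ)))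
    (hθ₂ : ∀ t : Set.Icc (0 : ℝ) T₀,
      θ₂ t = θ₂ ⟨0, Set.left_mem_Icc.mpr hT₀.le⟩ +
        ∫ s in {u : Set.Icc (0 : ℝ) T₀ | (u : ℝ) ≤ (t : ℝ)},
          ∫ x, gradA σ x (θ₂ s) (η₂.map (fun ω : PathSpace d' T₀ => ω s)) ∂(κ (s : ℝ))) :
    ∀ s : Set.Icc (0 : ℝ) T₀,
      pnorm (θ₁ s - θ₂ s) ≤
        (T₀ * (2 * Cσ ^ 2 * Ctraj * Lσ * Cπ ^ 2 + 2 * Ctraj ^ 2 * Cπ ^ 3 * Cσ ^ 2 * Lσ) *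
            Real.sqrt (∫ p, (⨆ u : Set.Icc (0 : ℝ) T₀, pnorm (p.1 u - p.2 u) ^ 2) ∂μ) +
          pnorm (θ₁ ⟨0, Set.left_mem_Icc.mpr hT₀.le⟩ - θ₂ ⟨0, Set.left_mem_Icc.mpr hT₀.le⟩)) *
          Real.exp ((2 * Cσ ^ 2 * Ctraj * Lσ * Cπ ^ 2 + 2 * Ctraj ^ 2 * Cπ ^ 3 * Cσ ^ 2 * Lσ)
            * T₀) := by
  set C := 2 * Cσ ^ 2 * Ctraj * Lσ * Cπ ^ 2 + 2 * Ctraj ^ 2 * Cπ ^ 3 * Cσ ^ 2 * Lσ with hCdef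
  set D := Real.sqrt (∫ p, (⨆ u : Set.Icc (0 : ℝ) T₀, pnorm (p.1 u - p.2 u) ^ 2) ∂μ) with hDdef
  have hC0 : 0 ≤ C := by positivity
  have hD0 : 0 ≤ D := Real.sqrt_nonneg _
  have hσc := hσdiff.continuous
  have hσ'c := hσ'Lip.continuous
  set t0 : Set.Icc (0 : ℝ) T₀ := ⟨0, Set.left_mem_Icc.mpr hT₀.le⟩ with ht0
  have hfin : IsFiniteMeasure (volume : Measure (Set.Icc (0 : ℝ) T₀)) := by
    refine ⟨?_⟩
    rw [Measure.Subtype.volume_univ measurableSet_Icc.nullMeasurableSet]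
    simp
  have hvol : ∀ S : Set (Set.Icc (0 : ℝ) T₀), (volume S).toReal ≤ T₀ := by
    intro S
    have h1 : volume S ≤ ENNReal.ofReal T₀ := by
      refine (measure_mono (Set.subset_univ S)).trans ?_
      rw [Measure.Subtype.volume_univ measurableSet_Icc.nullMeasurableSet]
      simp
    exact ENNReal.toReal_le_of_le_ofReal hT₀.le h1
  set h₁ : Set.Icc (0 : ℝ) T₀ → Param d' := fun s =>
    ∫ x, gradA σ x (θ₁ s) (η₁.map (fun ω : PathSpace d' T₀ => ω s)) ∂(κ (s : ℝ)) with hh₁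
  set h₂ : Set.Icc (0 : ℝ) T₀ → Param d' := fun s =>
    ∫ x, gradA σ x (θ₂ s) (η₂.map (fun ω : PathSpace d' T₀ => ω s)) ∂(κ (s : ℝ)) with hh₂
  set B := (Cπ + Ctraj * Cσ) * Cσ + (Cπ + Ctraj * Cσ) * Ctraj * Cσ * Cπ with hB
  have ih₁ : Integrable h₁ volume := by
    refine Integrable.of_bound (inner_measurable hσc hσ'c η₁ κ θ₁).aestronglyMeasurable B
      (Eventually.of_forall fun s => ?_)
    have := norm_integral_le_of_norm_le_const (μ := κ (s : ℝ)) (C := B)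
      (f := fun x => gradA σ x (θ₁ s) (η₁.map (fun ω : PathSpace d' T₀ => ω s))) (by
        filter_upwards [hκ s s.2] with x hx
        exact gradA_bound hσbd hσ'bd x hx _ (hθ₁bd s) _
          (netF_bound hσc η₁ hσbd (by linarith) hη₁ s _))
    simpa using this
  have ih₂ : Integrable h₂ volume := by
    refine Integrable.of_bound (inner_measurable hσc hσ'c η₂ κ θ₂).aestronglyMeasurable B
      (Eventually.of_forall fun s => ?_)
    have := norm_integral_le_of_norm_le_const (μ := κ (s : ℝ)) (C := B)
      (f := fun x => gradA σ x (θ₂ s) (η₂.map (fun ω : PathSpace d' T₀ => ω s))) (by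
        filter_upwards [hκ s s.2] with x hx
        exact gradA_bound hσbd hσ'bd x hx _ (hθ₂bd s) _
          (netF_bound hσc η₂ hσbd (by linarith) hη₂ s _))
    simpa using this
  have hdiff : ∀ s, pnorm (h₁ s - h₂ s) ≤ C * pnorm (θ₁ s - θ₂ s) + C * D := by
    intro s
    simp only [hh₁, hh₂]
    rw [← integral_sub (hθ₁int s) (hθ₂int s)]
    refine (pnorm_integral_le _ _).trans ?_
    have := norm_integral_le_of_norm_le_const (μ := κ (s : ℝ))
      (C := C * pnorm (θ₁ s - θ₂ s) + C * D)
      (f := fun x => pnorm (gradA σ x (θ₁ s) (η₁.map (fun ω : PathSpace d' T₀ => ω s)) -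
        gradA σ x (θ₂ s) (η₂.map (fun ω : PathSpace d' T₀ => ω s)))) (by
        filter_upwards [hκ s s.2] with x hx
        rw [Real.norm_of_nonneg (pnorm_nonneg _)]
        have hz : ‖x.1‖ ≤ Cπ :=
          le_trans (Real.le_sqrt_of_sq_le (by nlinarith [sq_nonneg x.2])) hx
        exact gradA_diff hσdiff hσbd hσ'bd hCσ hLσ hσ'Lip hCtraj hCπ x hx _ _ (hθ₁bd s) (hθ₂bd s)
          _ _ (netF_bound hσc η₁ hσbd (by linarith) hη₁ s _) hD0
          (netF_diff hT₀ hσdiff hσbd hσ'bd (by linarith) (by linarith) (by linarith) η₁ η₂ hη₁ hη₂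
            μ hμ₁ hμ₂ s _ hz))
    refine (le_abs_self _).trans ?_
    simpa using this
  have huc : Continuous (fun s => pnorm (θ₁ s - θ₂ s)) :=
    continuous_pnorm.comp (by fun_prop)
  have hui : Integrable (fun s => pnorm (θ₁ s - θ₂ s)) volume := by
    refine Integrable.of_bound huc.measurable.aestronglyMeasurable (Ctraj + Ctraj)
      (Eventually.of_forall fun s => ?_)
    rw [Real.norm_of_nonneg (pnorm_nonneg _)]
    have : pnorm (θ₁ s - θ₂ s) ≤ pnorm (θ₁ s) + pnorm (θ₂ s) := by
      simp only [pnorm_eq, WithLp.toLp_sub]; exact norm_sub_le _ _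
    linarith [hθ₁bd s, hθ₂bd s]
  have hnn := pnorm_nonneg (θ₁ t0 - θ₂ t0)
  refine gronwall_Icc hT₀ hC0 ⟨fun s => pnorm (θ₁ s - θ₂ s), huc⟩ ?_ (by positivity)
  intro t
  simp only [ContinuousMap.coe_mk]
  set S : Set (Set.Icc (0 : ℝ) T₀) := {v : Set.Icc (0 : ℝ) T₀ | (v : ℝ) ≤ (t : ℝ)} with hS
  have e : θ₁ t - θ₂ t = (θ₁ t0 - θ₂ t0) + ∫ s in S, (h₁ s - h₂ s) := by
    rw [integral_sub ih₁.integrableOn ih₂.integrableOn, hθ₁ t, hθ₂ t]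
    abel
  rw [e]
  have k1 : pnorm (∫ s in S, (h₁ s - h₂ s)) ≤ ∫ s in S, (C * pnorm (θ₁ s - θ₂ s) + C * D) := by
    refine (pnorm_integral_le _ _).trans ?_
    refine integral_mono_of_nonneg (Eventually.of_forall fun s => pnorm_nonneg _) ?_
      (Eventually.of_forall hdiff)
    exact ((hui.const_mul C).add (integrable_const _)).integrableOn
  have k2 : ∫ s in S, (C * pnorm (θ₁ s - θ₂ s) + C * D) ≤
      (∫ s in S, C * pnorm (θ₁ s - θ₂ s)) + T₀ * C * D := by
    rw [integral_add (hui.const_mul C).integrableOn (integrable_const _)]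
    gcongr
    rw [setIntegral_const, smul_eq_mul, mul_assoc]
    exact mul_le_mul_of_nonneg_right (hvol S) (by positivity)
  linarith [pnorm_add_le (θ₁ t0 - θ₂ t0) (∫ s in S, (h₁ s - h₂ s))]
end
end
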